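/- Let x ∈ ℝ² with x ∉ 2πℤ², and define for λ > 0 the function N_x(λ) := (2π)^{−2} Σ_{k ∈ ℤ², 0 < |k| < λ} e^{i⟨x,k⟩} (a finite sum). Then lim_{Q → ∞} limsup_{T → +∞} (1/T) ∫_1^T | λ^{−1/2} N_x(λ) − Σ_{η ∈ 2πℤ², |η| ≤ Q} 2 sin( λ |x + η| − π/4 ) / ( (2π)^{3/2} |x + η|^{3/2} ) |² dλ = 0. -/

import Mathlib

open MeasureTheory Real Filter

/-- The standard inner product on `ℝ²` (as `ℝ × ℝ`). -/
def ip2 (a b : ℝ × ℝ) : ℝ := a.1 * b.1 + a.2 * b.2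

/-- The Euclidean norm on `ℝ²` (as `ℝ × ℝ`). -/
noncomputable def nrm2 (a : ℝ × ℝ) : ℝ := Real.sqrt (a.1 ^ 2 + a.2 ^ 2)

/-- Three lattice points in a thin shell of the shifted lattice cannot be collinear with the
base point in the middle. -/
lemma shell_not_middle {u₁ u₂ v₁ v₂ : ℤ} {w₁ w₂ : ℝ}
    (hu : |(u₁ : ℝ) ^ 2 + (u₂ : ℝ) ^ 2 + 2 * (u₁ * w₁ + u₂ * w₂)| < 1)
    (hv : |(v₁ : ℝ) ^ 2 + (v₂ : ℝ) ^ 2 + 2 * (v₁ * w₁ + v₂ * w₂)| < 1)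
    (hD : u₁ * v₂ - u₂ * v₁ = 0) (hneg : u₁ * v₁ + u₂ * v₂ < 0) : False := by
  have hP : (1 : ℝ) ≤ -((u₁ : ℝ) * v₁ + u₂ * v₂) := by
    have : (1 : ℤ) ≤ -(u₁ * v₁ + u₂ * v₂) := by omega
    exact_mod_cast this
  have hA : (0 : ℝ) ≤ (u₁ : ℝ) ^ 2 + (u₂ : ℝ) ^ 2 := by positivity
  have hD' : (u₁ : ℝ) * v₂ - u₂ * v₁ = 0 := by exact_mod_cast hD
  rw [abs_lt] at hu hv
  set A := (u₁ : ℝ) ^ 2 + (u₂ : ℝ) ^ 2 with hAd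
  set P := -((u₁ : ℝ) * v₁ + u₂ * v₂) with hPd
  have key : A * ((v₁ : ℝ) ^ 2 + (v₂ : ℝ) ^ 2 + 2 * (v₁ * w₁ + v₂ * w₂))
      + P * (A + 2 * (u₁ * w₁ + u₂ * w₂)) = P * (P + A) := by
    have h1 : A * ((v₁ : ℝ) ^ 2 + (v₂ : ℝ) ^ 2) = P ^ 2 := by
      have : A * ((v₁ : ℝ) ^ 2 + (v₂ : ℝ) ^ 2) - P ^ 2 = ((u₁ : ℝ) * v₂ - u₂ * v₁) ^ 2 := by
        rw [hAd, hPd]; ring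
      rw [hD'] at this; linarith
    have h2 : A * ((v₁ : ℝ) * w₁ + v₂ * w₂) + P * (u₁ * w₁ + u₂ * w₂) = 0 := by
      have : A * ((v₁ : ℝ) * w₁ + v₂ * w₂) + P * (u₁ * w₁ + u₂ * w₂)
          = ((u₁ : ℝ) * v₂ - u₂ * v₁) * (u₁ * w₂ - u₂ * w₁) := by
        rw [hAd, hPd]; ring
      rw [this, hD']; ring
    linear_combination h1 + 2 * h2
  nlinarith [mul_nonneg hA (sub_nonneg.2 hv.2.le), mul_pos (by linarith : 0 < P)
    (sub_pos.2 hu.2)]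

/-- A determinant bound for lattice points close to a circle. -/
lemma shell_det {u₁ u₂ v₁ v₂ : ℤ} {w₁ w₂ L : ℝ}
    (hu : |(u₁ : ℝ) ^ 2 + (u₂ : ℝ) ^ 2 + 2 * (u₁ * w₁ + u₂ * w₂)| < 1)
    (hv : |(v₁ : ℝ) ^ 2 + (v₂ : ℝ) ^ 2 + 2 * (v₁ * w₁ + v₂ * w₂)| < 1)
    (hL : 0 ≤ L)
    (hu1 : |(u₁ : ℝ)| ≤ L) (hu2 : |(u₂ : ℝ)| ≤ L) (hv1 : |(v₁ : ℝ)| ≤ L) (hv2 : |(v₂ : ℝ)| ≤ L)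
    (hw : 2 * (L * (2 * L ^ 2 + 1)) ^ 2 < w₁ ^ 2 + w₂ ^ 2) :
    u₁ * v₂ - u₂ * v₁ = 0 := by
  set X := (u₁ : ℝ) * w₁ + u₂ * w₂ with hX
  set Y := (v₁ : ℝ) * w₁ + v₂ * w₂ with hY
  have sqb : ∀ t : ℝ, |t| ≤ L → t ^ 2 ≤ L ^ 2 := fun t ht => by
    rw [← sq_abs]; exact pow_le_pow_left₀ (abs_nonneg _) ht 2
  have hXb : |X| ≤ (2 * L ^ 2 + 1) / 2 := by
    rw [abs_lt] at hu; rw [abs_le]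
    constructor <;> nlinarith [sqb _ hu1, sqb _ hu2, sq_nonneg (u₁ : ℝ), sq_nonneg (u₂ : ℝ)]
  have hYb : |Y| ≤ (2 * L ^ 2 + 1) / 2 := by
    rw [abs_lt] at hv; rw [abs_le]
    constructor <;> nlinarith [sqb _ hv1, sqb _ hv2, sq_nonneg (v₁ : ℝ), sq_nonneg (v₂ : ℝ)]
  set B := (2 * L ^ 2 + 1) / 2 with hB
  have hB0 : 0 ≤ B := by positivity
  have comb : ∀ p q : ℝ, |p| ≤ L → |q| ≤ L → |p * Y - q * X| ≤ 2 * (L * B) := by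
    intro p q hp hq
    calc |p * Y - q * X| ≤ |p * Y| + |q * X| := abs_sub _ _
      _ = |p| * |Y| + |q| * |X| := by rw [abs_mul, abs_mul]
      _ ≤ L * B + L * B := by gcongr
      _ = _ := by ring
  have h1 := comb _ _ hu1 hv1
  have h2 := comb _ _ hu2 hv2
  have e : ((u₁ : ℝ) * v₂ - u₂ * v₁) ^ 2 * (w₁ ^ 2 + w₂ ^ 2)
      = (u₁ * Y - v₁ * X) ^ 2 + (u₂ * Y - v₂ * X) ^ 2 := by
    rw [hX, hY]; ring
  have s1 := sq_le_sq' (abs_le.1 h1).1 (abs_le.1 h1).2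
  have s2 := sq_le_sq' (abs_le.1 h2).1 (abs_le.1 h2).2
  have hlt : ((u₁ : ℝ) * v₂ - u₂ * v₁) ^ 2 < 1 := by
    by_contra hcon
    push Not at hcon
    have hB2 : 2 * (L * B) = L * (2 * L ^ 2 + 1) := by rw [hB]; ring
    rw [hB2] at s1 s2
    nlinarith [mul_le_mul_of_nonneg_right hcon (by positivity : 0 ≤ w₁ ^ 2 + w₂ ^ 2)]
  have hlt' : (u₁ * v₂ - u₂ * v₁) ^ 2 < 1 := by exact_mod_cast hlt
  have : |u₁ * v₂ - u₂ * v₁| < 1 := (sq_lt_one_iff_abs_lt_one _).1 hlt'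
  exact Int.abs_lt_one_iff.1 this

/-- A short arc of a thin shell contains no three lattice points. -/
lemma shell_no_three {a : ℝ × ℝ} {V L : ℝ} (hL : 0 ≤ L)
    (hV : 2 * (L * (2 * L ^ 2 + 1)) ^ 2 < V) {p q r : ℤ × ℤ}
    (hp : V ≤ (a.1 + p.1) ^ 2 + (a.2 + p.2) ^ 2 ∧ (a.1 + p.1) ^ 2 + (a.2 + p.2) ^ 2 < V + 1)
    (hq : V ≤ (a.1 + q.1) ^ 2 + (a.2 + q.2) ^ 2 ∧ (a.1 + q.1) ^ 2 + (a.2 + q.2) ^ 2 < V + 1)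
    (hr : V ≤ (a.1 + r.1) ^ 2 + (a.2 + r.2) ^ 2 ∧ (a.1 + r.1) ^ 2 + (a.2 + r.2) ^ 2 < V + 1)
    (hpq : p ≠ q) (hpr : p ≠ r) (hqr : q ≠ r)
    (hq1 : |((q.1 - p.1 : ℤ) : ℝ)| ≤ L) (hq2 : |((q.2 - p.2 : ℤ) : ℝ)| ≤ L)
    (hr1 : |((r.1 - p.1 : ℤ) : ℝ)| ≤ L) (hr2 : |((r.2 - p.2 : ℤ) : ℝ)| ≤ L) : False := by
  have diff : ∀ s t : ℤ × ℤ,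
      (V ≤ (a.1 + s.1) ^ 2 + (a.2 + s.2) ^ 2 ∧ (a.1 + s.1) ^ 2 + (a.2 + s.2) ^ 2 < V + 1) →
      (V ≤ (a.1 + t.1) ^ 2 + (a.2 + t.2) ^ 2 ∧ (a.1 + t.1) ^ 2 + (a.2 + t.2) ^ 2 < V + 1) →
      |((t.1 - s.1 : ℤ) : ℝ) ^ 2 + ((t.2 - s.2 : ℤ) : ℝ) ^ 2 + 2 * (((t.1 - s.1 : ℤ) : ℝ) *
        (a.1 + s.1) + ((t.2 - s.2 : ℤ) : ℝ) * (a.2 + s.2))| < 1 := by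
    intro s t hs ht
    have : ((t.1 - s.1 : ℤ) : ℝ) ^ 2 + ((t.2 - s.2 : ℤ) : ℝ) ^ 2 + 2 * (((t.1 - s.1 : ℤ) : ℝ) *
        (a.1 + s.1) + ((t.2 - s.2 : ℤ) : ℝ) * (a.2 + s.2)) =
        ((a.1 + t.1) ^ 2 + (a.2 + t.2) ^ 2) - ((a.1 + s.1) ^ 2 + (a.2 + s.2) ^ 2) := by
      push_cast; ring
    rw [this, abs_lt]; constructor <;> linarith [hs.1, hs.2, ht.1, ht.2]
  have hD := shell_det (diff p q hp hq) (diff p r hp hr) hL hq1 hq2 hr1 hr2 (hV.trans_le hp.1)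
  have n1 := fun h => shell_not_middle (diff p q hp hq) (diff p r hp hr) hD h
  have n2 := fun h => shell_not_middle (diff q p hq hp) (diff q r hq hr)
    (by linear_combination -hD) h
  have n3 := fun h => shell_not_middle (diff r p hr hp) (diff r q hr hq)
    (by linear_combination hD) h
  have m1 := not_lt.1 n1
  have m2 := not_lt.1 n2
  have m3 := not_lt.1 n3
  set u₁ := q.1 - p.1 with hu₁
  set u₂ := q.2 - p.2 with hu₂
  set v₁ := r.1 - p.1 with hv₁
  set v₂ := r.2 - p.2 with hv₂
  have e1 : p.1 - q.1 = -u₁ := by omega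
  have e2 : p.2 - q.2 = -u₂ := by omega
  have e3 : p.1 - r.1 = -v₁ := by omega
  have e4 : p.2 - r.2 = -v₂ := by omega
  have e5 : r.1 - q.1 = v₁ - u₁ := by omega
  have e6 : r.2 - q.2 = v₂ - u₂ := by omega
  have e7 : q.1 - r.1 = u₁ - v₁ := by omega
  have e8 : q.2 - r.2 = u₂ - v₂ := by omega
  rw [e1, e2, e5, e6] at m2
  rw [e3, e4, e7, e8] at m3
  have pos : ∀ s t : ℤ × ℤ, s ≠ t → 0 < (t.1 - s.1) ^ 2 + (t.2 - s.2) ^ 2 := by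
    intro s t hst
    rcases eq_or_ne s.1 t.1 with h | h
    · have h2 : t.2 - s.2 ≠ 0 := fun h2 => hst (Prod.ext h (by omega))
      positivity
    · have h2 : t.1 - s.1 ≠ 0 := by omega
      positivity
  have p1 := pos p q hpq
  have p2 := pos p r hpr
  have p3 := pos q r hqr
  rw [e5, e6] at p3
  rw [← hu₁, ← hu₂] at p1
  rw [← hv₁, ← hv₂] at p2
  set A := u₁ ^ 2 + u₂ ^ 2
  set B := v₁ ^ 2 + v₂ ^ 2
  set P := u₁ * v₁ + u₂ * v₂ with hP
  have hAB : A * B = P ^ 2 := by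
    have : A * B - P ^ 2 = (u₁ * v₂ - u₂ * v₁) ^ 2 := by simp only [A, B, P]; ring
    rw [hD] at this; linarith
  have k2 : P ≤ A := by simp only [A, P]; linarith
  have k3 : P ≤ B := by simp only [B, P]; linarith
  have k4 : 0 < A + B - 2 * P := by
    have : A + B - 2 * P = (v₁ - u₁) ^ 2 + (v₂ - u₂) ^ 2 := by simp only [A, B, P]; ring
    rw [this]; exact p3
  nlinarith [mul_nonneg (sub_nonneg.2 k2) (sub_nonneg.2 k3), mul_nonneg m1 (sub_nonneg.2 k2),
    mul_nonneg m1 (sub_nonneg.2 k3), mul_pos p1 p2]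

lemma shell_coord_close {p q p' q' s : ℝ} (h1 : |p| ≤ q) (h2 : |p'| ≤ q') (hq : 1 / 2 ≤ q)
    (hq' : 1 / 2 ≤ q') (h : |(p' ^ 2 + q' ^ 2) - (p ^ 2 + q ^ 2)| < 1) (hs : |p' - p| ≤ s) :
    |q' - q| ≤ s + 1 := by
  have e : (p' ^ 2 + q' ^ 2) - (p ^ 2 + q ^ 2) = (q' - q) * (q' + q) + (p' - p) * (p' + p) := by
    ring
  have h3 : |(q' - q) * (q' + q)| ≤ 1 + |(p' - p) * (p' + p)| := by
    have := abs_sub_abs_le_abs_sub ((q' - q) * (q' + q)) (-((p' - p) * (p' + p)))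
    rw [abs_neg, sub_neg_eq_add, ← e] at this
    linarith
  have hpos : 1 ≤ q' + q := by linarith
  rw [abs_mul, abs_mul, abs_of_pos (by linarith : 0 < q' + q)] at h3
  have h4 : |p' + p| ≤ q' + q := (abs_add_le _ _).trans (by linarith)
  have h5 : |p' - p| * |p' + p| ≤ s * (q' + q) :=
    mul_le_mul hs h4 (abs_nonneg _) ((abs_nonneg _).trans hs)
  by_contra hcon
  push Not at hcon
  nlinarith

/-- The dominating coordinate, its sign, and the block of the other coordinate. -/
noncomputable def shellKey (a : ℝ × ℝ) (s : ℝ) (k : ℤ × ℤ) : Bool × Bool × ℤ := by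
  classical
  exact if |a.1 + k.1| ≤ |a.2 + k.2| then (true, decide (0 ≤ a.2 + k.2), ⌊(a.1 + k.1) / s⌋)
  else (false, decide (0 ≤ a.1 + k.1), ⌊(a.2 + k.2) / s⌋)

lemma abs_sub_le_of_floor_div_eq {p q s : ℝ} (hs : 0 < s) (h : ⌊p / s⌋ = ⌊q / s⌋) :
    |p - q| ≤ s := by
  have := (Int.abs_sub_lt_one_of_floor_eq_floor h).le
  rw [← sub_div, abs_div, abs_of_pos hs, div_le_one hs] at this
  exact this

lemma shellKey_close {a : ℝ × ℝ} {s V : ℝ} (hs : 1 ≤ s) (hV : 1 ≤ V) {p q : ℤ × ℤ}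
    (hp : V ≤ (a.1 + p.1) ^ 2 + (a.2 + p.2) ^ 2 ∧ (a.1 + p.1) ^ 2 + (a.2 + p.2) ^ 2 < V + 1)
    (hq : V ≤ (a.1 + q.1) ^ 2 + (a.2 + q.2) ^ 2 ∧ (a.1 + q.1) ^ 2 + (a.2 + q.2) ^ 2 < V + 1)
    (h : shellKey a s p = shellKey a s q) :
    |((q.1 - p.1 : ℤ) : ℝ)| ≤ 2 * s ∧ |((q.2 - p.2 : ℤ) : ℝ)| ≤ 2 * s := by
  have hs0 : 0 < s := by linarith
  have half : ∀ u v : ℝ, |u| ≤ v → V ≤ u ^ 2 + v ^ 2 → 1 / 2 ≤ v := by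
    intro u v huv hV'
    have h1 := sq_le_sq' (by linarith [(abs_le.1 huv).1]) (abs_le.1 huv).2
    nlinarith [(abs_nonneg u).trans huv]
  have hd : |((a.1 + q.1) ^ 2 + (a.2 + q.2) ^ 2) - ((a.1 + p.1) ^ 2 + (a.2 + p.2) ^ 2)| < 1 := by
    rw [abs_lt]; constructor <;> linarith [hp.1, hp.2, hq.1, hq.2]
  have c1 : ((q.1 - p.1 : ℤ) : ℝ) = (a.1 + q.1) - (a.1 + p.1) := by push_cast; ring
  have c2 : ((q.2 - p.2 : ℤ) : ℝ) = (a.2 + q.2) - (a.2 + p.2) := by push_cast; ring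
  rw [c1, c2]
  obtain ⟨hp, -⟩ := hp
  obtain ⟨hq, -⟩ := hq
  unfold shellKey at h
  generalize a.1 + (q.1 : ℝ) = q₁ at *
  generalize a.2 + (q.2 : ℝ) = q₂ at *
  generalize a.1 + (p.1 : ℝ) = p₁ at *
  generalize a.2 + (p.2 : ℝ) = p₂ at *
  split_ifs at h with h1 h2 h2
  · simp only [Prod.mk.injEq, true_and, decide_eq_decide] at h
    have hf := abs_sub_le_of_floor_div_eq hs0 h.2
    rw [abs_sub_comm] at hf
    refine ⟨by linarith, ?_⟩
    by_cases h0 : 0 ≤ p₂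
    · have h0' := h.1.1 h0
      rw [abs_of_nonneg h0] at h1
      rw [abs_of_nonneg h0'] at h2
      linarith [shell_coord_close h1 h2 (half _ _ h1 hp) (half _ _ h2 hq) hd hf]
    · have h0' := fun h' => h0 (h.1.2 h')
      rw [abs_of_neg (not_le.1 h0)] at h1
      rw [abs_of_neg (not_le.1 h0')] at h2
      have := shell_coord_close h1 h2 (half _ _ h1 (by rw [neg_sq]; exact hp))
        (half _ _ h2 (by rw [neg_sq]; exact hq)) (by rw [neg_sq, neg_sq]; exact hd) hf
      rw [show q₂ - p₂ = -(-q₂ - -p₂) by ring, abs_neg]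
      linarith
  · simp at h
  · simp at h
  · simp only [Prod.mk.injEq, true_and, decide_eq_decide] at h
    have hf := abs_sub_le_of_floor_div_eq hs0 h.2
    rw [abs_sub_comm] at hf
    refine ⟨?_, by linarith⟩
    have h1 := (not_le.1 h1).le
    have h2 := (not_le.1 h2).le
    have hd : |(q₂ ^ 2 + q₁ ^ 2) - (p₂ ^ 2 + p₁ ^ 2)| < 1 := by
      rwa [add_comm (q₂ ^ 2), add_comm (p₂ ^ 2)]
    have hp : V ≤ p₂ ^ 2 + p₁ ^ 2 := by linarith
    have hq : V ≤ q₂ ^ 2 + q₁ ^ 2 := by linarith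
    by_cases h0 : 0 ≤ p₁
    · have h0' := h.1.1 h0
      rw [abs_of_nonneg h0] at h1
      rw [abs_of_nonneg h0'] at h2
      linarith [shell_coord_close h1 h2 (half _ _ h1 hp) (half _ _ h2 hq) hd hf]
    · have h0' := fun h' => h0 (h.1.2 h')
      rw [abs_of_neg (not_le.1 h0)] at h1
      rw [abs_of_neg (not_le.1 h0')] at h2
      have := shell_coord_close h1 h2 (half _ _ h1 (by rw [neg_sq]; exact hp))
        (half _ _ h2 (by rw [neg_sq]; exact hq)) (by rw [neg_sq, neg_sq]; exact hd) hf
      rw [show q₁ - p₁ = -(-q₁ - -p₁) by ring, abs_neg]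
      linarith

lemma card_le_of_mem_box {a : ℝ × ℝ} {S : Finset (ℤ × ℤ)} {B : ℝ} (hB : 0 ≤ B)
    (h : ∀ k ∈ S, |a.1 + k.1| ≤ B ∧ |a.2 + k.2| ≤ B) : (S.card : ℝ) ≤ (2 * B + 1) ^ 2 := by
  have hsub : S ⊆ Finset.Icc ⌈-B - a.1⌉ ⌊B - a.1⌋ ×ˢ Finset.Icc ⌈-B - a.2⌉ ⌊B - a.2⌋ := by
    intro k hk
    obtain ⟨h1, h2⟩ := h k hk
    rw [abs_le] at h1 h2
    simp only [Finset.mem_product, Finset.mem_Icc, Int.ceil_le, Int.le_floor]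
    refine ⟨⟨?_, ?_⟩, ?_, ?_⟩ <;> linarith
  have hc : ∀ t : ℝ, ((Finset.Icc ⌈-B - t⌉ ⌊B - t⌋).card : ℝ) ≤ 2 * B + 1 := by
    intro t
    rw [Int.card_Icc]
    have h1 := Int.le_ceil (-B - t)
    have h2 := Int.floor_le (B - t)
    rcases le_total 0 (⌊B - t⌋ + 1 - ⌈-B - t⌉) with h0 | h0
    · have : (((⌊B - t⌋ + 1 - ⌈-B - t⌉).toNat : ℤ) : ℝ) = ((⌊B - t⌋ + 1 - ⌈-B - t⌉ : ℤ) : ℝ) := by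
        rw [Int.toNat_of_nonneg h0]
      rw [Int.cast_natCast] at this
      rw [this]; push_cast; linarith
    · rw [Int.toNat_of_nonpos h0]; simp; linarith
  calc (S.card : ℝ) ≤ ((Finset.Icc ⌈-B - a.1⌉ ⌊B - a.1⌋ ×ˢ Finset.Icc ⌈-B - a.2⌉ ⌊B - a.2⌋).card : ℝ) := by
        exact_mod_cast Finset.card_le_card hsub
    _ = ((Finset.Icc ⌈-B - a.1⌉ ⌊B - a.1⌋).card : ℝ) * ((Finset.Icc ⌈-B - a.2⌉ ⌊B - a.2⌋).card : ℝ) := by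
        rw [Finset.card_product]; push_cast; ring
    _ ≤ (2 * B + 1) * (2 * B + 1) := by gcongr <;> exact hc _
    _ = _ := by ring

/-- A thin shell of radius `√V` contains `O(V ^ (1/3))` points of a shifted lattice. -/
lemma shell_card_le (a : ℝ × ℝ) {V : ℝ} (hV : 0 ≤ V) {S : Finset (ℤ × ℤ)}
    (hS : ∀ k ∈ S, V ≤ (a.1 + k.1) ^ 2 + (a.2 + k.2) ^ 2 ∧
      (a.1 + k.1) ^ 2 + (a.2 + k.2) ^ 2 < V + 1) :
    (S.card : ℝ) ≤ 4000 * (1 + V) ^ (1 / 3 : ℝ) := by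
  have h1V : 1 ≤ (1 + V) ^ (1 / 3 : ℝ) := Real.one_le_rpow (by linarith) (by norm_num)
  rcases lt_or_ge V 729 with hsmall | hbig
  · have := card_le_of_mem_box (a := a) (S := S) (B := 28) (by norm_num) (by
      intro k hk
      have := (hS k hk).2
      constructor <;> apply abs_le_of_sq_le_sq _ (by norm_num) <;>
        nlinarith [sq_nonneg (a.1 + k.1), sq_nonneg (a.2 + k.2)])
    linarith
  · set s := V ^ (1 / 6 : ℝ) / 3 with hs
    have hs6 : s ^ 6 = V / 729 := by
      rw [hs, div_pow, ← Real.rpow_natCast, ← Real.rpow_mul hV]; norm_num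
    have hs1 : 1 ≤ s := by
      by_contra hcon
      push Not at hcon
      have : s ^ 6 < 1 := pow_lt_one₀ (by positivity) hcon (by norm_num)
      rw [hs6] at this; linarith
    have hs2 : s ^ 2 * 9 = V ^ (1 / 3 : ℝ) := by
      rw [hs, div_pow, ← Real.rpow_natCast, ← Real.rpow_mul hV]; norm_num
    have hs0 : 0 < s := by linarith
    have hL : 2 * ((2 * s) * (2 * (2 * s) ^ 2 + 1)) ^ 2 < V := by
      have h1 : (2 * s) * (2 * (2 * s) ^ 2 + 1) ≤ 18 * s ^ 3 := by nlinarith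
      have h2 : ((2 * s) * (2 * (2 * s) ^ 2 + 1)) ^ 2 ≤ (18 * s ^ 3) ^ 2 :=
        pow_le_pow_left₀ (by positivity) h1 2
      have h3 : (18 * s ^ 3) ^ 2 = 324 * s ^ 6 := by ring
      rw [h3, hs6] at h2
      linarith
    set N : ℕ := ⌈6 * s ^ 2⌉₊ with hN
    have hcoord : ∀ u v : ℝ, u ^ 2 + v ^ 2 < V + 1 → ⌊u / s⌋ ∈ Finset.Icc (-(N : ℤ) * 9) (N * 9) := by
      intro u v huv
      have hN' : 6 * s ^ 2 ≤ (N : ℝ) := Nat.le_ceil _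
      have hu : |u / s| ≤ 54 * s ^ 2 := by
        rw [abs_div, abs_of_pos hs0, div_le_iff₀ hs0]
        apply abs_le_of_sq_le_sq _ (by positivity)
        have : (54 * s ^ 2 * s) ^ 2 = 4 * V := by
          have : (54 * s ^ 2 * s) ^ 2 = 2916 * s ^ 6 := by ring
          rw [this, hs6]; ring
        rw [this]; nlinarith [sq_nonneg v]
      rw [abs_le] at hu
      rw [Finset.mem_Icc, Int.le_floor]
      constructor
      · push_cast; linarith
      · have : ⌊u / s⌋ ≤ ((N * 9 : ℤ)) := by
          have : ((⌊u / s⌋ : ℤ) : ℝ) ≤ ((N * 9 : ℤ) : ℝ) := by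
            push_cast; linarith [Int.floor_le (u / s)]
          exact_mod_cast this
        exact this
    have hcard := Finset.card_le_mul_card_image_of_maps_to (s := S) (f := shellKey a s)
      (t := Finset.univ ×ˢ Finset.univ ×ˢ Finset.Icc (-(N : ℤ) * 9) (N * 9))
      (by
        intro k hk
        have h := (hS k hk).2
        unfold shellKey
        split_ifs
        · simpa [le_or_gt] using hcoord _ _ h
        · rw [add_comm] at h
          simpa [le_or_gt] using hcoord _ _ h) 2
      (by
        intro b _
        by_contra hcon
        push Not at hcon
        obtain ⟨p, hp, q, hq, r, hr, hpq, hpr, hqr⟩ := Finset.two_lt_card.1 hcon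
        simp only [Finset.mem_filter] at hp hq hr
        have cq := shellKey_close hs1 (by linarith) (hS p hp.1) (hS q hq.1) (hp.2.trans hq.2.symm)
        have cr := shellKey_close hs1 (by linarith) (hS p hp.1) (hS r hr.1) (hp.2.trans hr.2.symm)
        exact shell_no_three (by positivity) hL (hS p hp.1) (hS q hq.1) (hS r hr.1) hpq hpr hqr
          cq.1 cq.2 cr.1 cr.2)
    rw [Finset.card_product, Finset.card_product] at hcard
    simp only [Finset.card_univ, Fintype.card_bool, Int.card_Icc] at hcard
    have hI : ((N * 9 : ℤ) + 1 - -(N : ℤ) * 9).toNat = 18 * N + 1 := by omega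
    rw [hI] at hcard
    have hcard' : (S.card : ℝ) ≤ 2 * (2 * (2 * (18 * N + 1))) := by exact_mod_cast hcard
    have hN2 : (N : ℝ) < 6 * s ^ 2 + 1 := Nat.ceil_lt_add_one (by positivity)
    have hV3 : V ^ (1 / 3 : ℝ) ≤ (1 + V) ^ (1 / 3 : ℝ) :=
      Real.rpow_le_rpow hV (by linarith) (by norm_num)
    nlinarith

/-- The length of the geodesic segment from `0` to `x` in the homotopy class of `m`. -/
noncomputable def rad (x : ℝ × ℝ) (m : ℤ × ℤ) : ℝ :=
  nrm2 (x.1 + 2 * Real.pi * m.1, x.2 + 2 * Real.pi * m.2)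

lemma rad_sq (x : ℝ × ℝ) (m : ℤ × ℤ) :
    rad x m ^ 2 = (2 * Real.pi) ^ 2 *
      ((x.1 / (2 * Real.pi) + m.1) ^ 2 + (x.2 / (2 * Real.pi) + m.2) ^ 2) := by
  unfold rad nrm2
  rw [Real.sq_sqrt (by positivity)]
  have := Real.pi_ne_zero
  field_simp

lemma rad_nonneg (x : ℝ × ℝ) (m : ℤ × ℤ) : 0 ≤ rad x m := Real.sqrt_nonneg _

lemma exists_rad_lower {x : ℝ × ℝ}
    (hx : ¬ ∃ m : ℤ × ℤ, x = (2 * Real.pi * m.1, 2 * Real.pi * m.2)) :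
    ∃ c : ℝ, 0 < c ∧ ∀ m : ℤ × ℤ, c * (1 + ‖m‖) ≤ rad x m := by
  have hπ := Real.pi_pos
  set a : ℝ × ℝ := (x.1 / (2 * Real.pi), x.2 / (2 * Real.pi)) with ha
  set d₁ := |a.1 - round a.1| with hd₁
  set d₂ := |a.2 - round a.2| with hd₂
  have hpos : 0 < max d₁ d₂ := by
    by_contra hcon
    have h1 : d₁ = 0 := le_antisymm ((le_max_left _ _).trans (not_lt.1 hcon)) (abs_nonneg _)
    have h2 : d₂ = 0 := le_antisymm ((le_max_right _ _).trans (not_lt.1 hcon)) (abs_nonneg _)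
    rw [hd₁, abs_eq_zero, sub_eq_zero, ha] at h1
    rw [hd₂, abs_eq_zero, sub_eq_zero, ha] at h2
    refine hx ⟨(round a.1, round a.2), Prod.ext ?_ ?_⟩
    · simp only at h1 ⊢
      rw [ha]; simp only
      rw [← h1]; field_simp
    · simp only at h2 ⊢
      rw [ha]; simp only
      rw [← h2]; field_simp
  set e := max d₁ d₂ with he
  have hround : ∀ (t : ℝ) (k : ℤ), |t - round t| ≤ |t + k| := by
    intro t k
    have := round_le t (-k)
    simpa using this
  have habs : ∀ m : ℤ × ℤ, ∀ t : ℝ, 0 ≤ t → (t ≤ |a.1 + m.1| ∨ t ≤ |a.2 + m.2|) →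
      2 * Real.pi * t ≤ rad x m := by
    intro m t ht h
    apply le_of_sq_le_sq _ (rad_nonneg x m)
    rw [rad_sq, mul_pow]
    gcongr
    have key : ∀ u : ℝ, t ≤ |u| → t ^ 2 ≤ u ^ 2 := fun u hu => by
      rw [← sq_abs u]; exact pow_le_pow_left₀ ht hu 2
    rcases h with h | h
    · have := key _ h
      simp only [ha] at this
      nlinarith [sq_nonneg (x.2 / (2 * Real.pi) + m.2)]
    · have := key _ h
      simp only [ha] at this
      nlinarith [sq_nonneg (x.1 / (2 * Real.pi) + m.1)]
  have hlow : ∀ m, 2 * Real.pi * e ≤ rad x m := by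
    intro m
    apply habs m e hpos.le
    rcases max_choice d₁ d₂ with h | h
    · left; rw [he, h]; exact hround _ _
    · right; rw [he, h]; exact hround _ _
  set A := max |a.1| |a.2| with hA
  have hA0 : 0 ≤ A := (abs_nonneg _).trans (le_max_left _ _)
  have hlow2 : ∀ m : ℤ × ℤ, 2 * Real.pi * (‖m‖ - A) ≤ rad x m := by
    intro m
    rcases le_total (‖m‖ - A) 0 with h | h
    · exact (mul_nonpos_of_nonneg_of_nonpos (by positivity) h).trans (rad_nonneg _ _)
    apply habs m _ h
    rw [Prod.norm_def]
    rcases max_choice ‖m.1‖ ‖m.2‖ with h' | h'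
    · left
      rw [h', Int.norm_eq_abs]
      have := abs_sub_abs_le_abs_sub (m.1 : ℝ) (-a.1)
      rw [abs_neg, sub_neg_eq_add, add_comm] at this
      linarith [le_max_left |a.1| |a.2|]
    · right
      rw [h', Int.norm_eq_abs]
      have := abs_sub_abs_le_abs_sub (m.2 : ℝ) (-a.2)
      rw [abs_neg, sub_neg_eq_add, add_comm] at this
      linarith [le_max_right |a.1| |a.2|]
  refine ⟨2 * Real.pi * e / (1 + e + A), by positivity, fun m => ?_⟩
  rw [div_mul_eq_mul_div, div_le_iff₀ (by positivity)]
  have h1 := hlow m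
  have h2 := hlow2 m
  nlinarith [mul_le_mul_of_nonneg_left h1 hA0, mul_le_mul_of_nonneg_left h2 hpos.le]

lemma summable_one_add_norm_rpow {p : ℝ} (hp : 2 < p) :
    Summable fun m : ℤ × ℤ => (1 + ‖m‖) ^ (-p) := by
  have h := EisensteinSeries.summable_one_div_norm_rpow hp
  have h2 : Summable fun m : ℤ × ℤ => ‖m‖ ^ (-p) := by
    rw [← (finTwoArrowEquiv ℤ).summable_iff]
    refine h.congr fun v => ?_
    congr 1
    simp only [Prod.norm_def, EisensteinSeries.norm_eq_max_natAbs]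
    simp [Int.norm_eq_abs, Nat.cast_natAbs]
  refine Summable.of_norm_bounded_eventually (g := fun m : ℤ × ℤ => ‖m‖ ^ (-p)) h2 ?_
  have : ({0} : Set (ℤ × ℤ))ᶜ ∈ (cofinite : Filter (ℤ × ℤ)) :=
    (Set.finite_singleton (0 : ℤ × ℤ)).compl_mem_cofinite
  filter_upwards [this] with m hm
  have hm0 : 0 < ‖m‖ := norm_pos_iff.2 hm
  rw [Real.norm_of_nonneg (by positivity)]
  exact Real.rpow_le_rpow_of_nonpos hm0 (by linarith) (by linarith)

lemma summable_rad_rpow {x : ℝ × ℝ}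
    (hx : ¬ ∃ m : ℤ × ℤ, x = (2 * Real.pi * m.1, 2 * Real.pi * m.2)) {p : ℝ} (hp : 2 < p) :
    Summable fun m : ℤ × ℤ => rad x m ^ (-p) := by
  obtain ⟨c, hc, h⟩ := exists_rad_lower hx
  refine Summable.of_nonneg_of_le (fun m => Real.rpow_nonneg (rad_nonneg _ _) _) (fun m => ?_)
    ((summable_one_add_norm_rpow hp).mul_left (c ^ (-p)))
  rw [← Real.mul_rpow hc.le (by positivity)]
  exact Real.rpow_le_rpow_of_nonpos (by positivity) (h m) (by linarith)

/-- Weighted counting of the lattice points outside a circle. -/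
lemma exists_shell_sum_bound : ∃ C : ℝ, 0 ≤ C ∧ ∀ (a : ℝ × ℝ) (V : ℝ), 0 ≤ V →
    ∀ S : Finset (ℤ × ℤ), (∀ k ∈ S, V ≤ (a.1 + k.1) ^ 2 + (a.2 + k.2) ^ 2) →
    ∑ k ∈ S, (1 + ((a.1 + k.1) ^ 2 + (a.2 + k.2) ^ 2 - V)) ^ (-(3 / 2) : ℝ)
      ≤ C * (1 + V) ^ (1 / 3 : ℝ) := by
  have hsum : Summable fun j : ℕ => (1 + (j : ℝ)) ^ (-(7 / 6) : ℝ) := by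
    have := (summable_nat_add_iff 1).2 (Real.summable_nat_rpow.2 (by norm_num : -(7 / 6 : ℝ) < -1))
    refine this.congr fun j => ?_
    push_cast; rw [add_comm]
  refine ⟨4000 * ∑' j : ℕ, (1 + (j : ℝ)) ^ (-(7 / 6) : ℝ),
    mul_nonneg (by norm_num) (tsum_nonneg fun j => by positivity), fun a V hV S hS => ?_⟩
  set n : ℤ × ℤ → ℝ := fun k => (a.1 + k.1) ^ 2 + (a.2 + k.2) ^ 2 with hn
  set j : ℤ × ℤ → ℕ := fun k => ⌊n k - V⌋₊ with hj
  calc ∑ k ∈ S, (1 + (n k - V)) ^ (-(3 / 2) : ℝ)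
      ≤ ∑ k ∈ S, (1 + (j k : ℝ)) ^ (-(3 / 2) : ℝ) := by
        refine Finset.sum_le_sum fun k hk => ?_
        refine Real.rpow_le_rpow_of_nonpos (by positivity) ?_ (by norm_num)
        have := Nat.floor_le (sub_nonneg.2 (hS k hk))
        linarith
    _ = ∑ b ∈ S.image j, ({k ∈ S | j k = b}.card) • (1 + (b : ℝ)) ^ (-(3 / 2) : ℝ) :=
        Finset.sum_comp (fun b : ℕ => (1 + (b : ℝ)) ^ (-(3 / 2) : ℝ)) j
    _ ≤ ∑ b ∈ S.image j, 4000 * (1 + V) ^ (1 / 3 : ℝ) * (1 + (b : ℝ)) ^ (-(7 / 6) : ℝ) := by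
        refine Finset.sum_le_sum fun b _ => ?_
        have hcard := shell_card_le a (V := V + b) (by positivity) (S := {k ∈ S | j k = b}) (by
          intro k hk
          rw [Finset.mem_filter] at hk
          have h0 := sub_nonneg.2 (hS k hk.1)
          have h1 := Nat.floor_le h0
          have h2 := Nat.lt_floor_add_one (n k - V)
          have h3 : ((⌊n k - V⌋₊ : ℕ) : ℝ) = b := by exact_mod_cast hk.2
          rw [h3] at h2
          have h1' : (b : ℝ) ≤ n k - V := by rw [← h3]; exact h1
          constructor <;> simp only [hn] at * <;> linarith)
        have h2 : (1 + (V + b)) ^ (1 / 3 : ℝ) ≤ (1 + V) ^ (1 / 3 : ℝ) * (1 + (b : ℝ)) ^ (1 / 3 : ℝ) := by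
          rw [← Real.mul_rpow (by positivity) (by positivity)]
          apply Real.rpow_le_rpow (by positivity) _ (by norm_num)
          nlinarith [mul_nonneg hV (Nat.cast_nonneg (α := ℝ) b)]
        have h3 : (1 + (b : ℝ)) ^ (-(7 / 6) : ℝ)
            = (1 + (b : ℝ)) ^ (1 / 3 : ℝ) * (1 + (b : ℝ)) ^ (-(3 / 2) : ℝ) := by
          rw [← Real.rpow_add (by positivity)]; norm_num
        rw [nsmul_eq_mul, h3]
        calc _ ≤ (4000 * ((1 + V) ^ (1 / 3 : ℝ) * (1 + (b : ℝ)) ^ (1 / 3 : ℝ)))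
              * (1 + (b : ℝ)) ^ (-(3 / 2) : ℝ) := by
              gcongr
              exact hcard.trans (by gcongr)
          _ = _ := by ring
    _ = 4000 * (1 + V) ^ (1 / 3 : ℝ) * ∑ b ∈ S.image j, (1 + (b : ℝ)) ^ (-(7 / 6) : ℝ) := by
        rw [Finset.mul_sum]
    _ ≤ 4000 * (1 + V) ^ (1 / 3 : ℝ) * ∑' b : ℕ, (1 + (b : ℝ)) ^ (-(7 / 6) : ℝ) := by
        gcongr
        exact hsum.sum_le_tsum _ fun b _ => by positivity
    _ = _ := by ring

/-- The one-sided pair correlation kernel of the lengths `rad x`. -/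
noncomputable def pairKernel (x : ℝ × ℝ) (q : (ℤ × ℤ) × (ℤ × ℤ)) : ℝ :=
  if rad x q.1 ≤ rad x q.2 then
    rad x q.1 ^ (-3 : ℝ) * (1 + (rad x q.2 ^ 2 - rad x q.1 ^ 2)) ^ (-(3 / 2) : ℝ) else 0

lemma pairKernel_nonneg (x : ℝ × ℝ) (q : (ℤ × ℤ) × (ℤ × ℤ)) : 0 ≤ pairKernel x q := by
  unfold pairKernel
  split_ifs with h
  · have := pow_le_pow_left₀ (rad_nonneg _ _) h 2
    have h2 : 0 ≤ 1 + (rad x q.2 ^ 2 - rad x q.1 ^ 2) := by linarith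
    have h3 := rad_nonneg x q.1
    positivity
  · exact le_rfl

lemma summable_pairKernel {x : ℝ × ℝ}
    (hx : ¬ ∃ m : ℤ × ℤ, x = (2 * Real.pi * m.1, 2 * Real.pi * m.2)) :
    Summable (pairKernel x) := by
  obtain ⟨C, hC, hb⟩ := exists_shell_sum_bound
  obtain ⟨c, hc, hlow⟩ := exists_rad_lower hx
  have hr : ∀ m, c ≤ rad x m := fun m =>
    le_trans (by nlinarith [norm_nonneg m]) (hlow m)
  have hπ : (1 : ℝ) ≤ (2 * Real.pi) ^ 2 := by nlinarith [Real.pi_gt_three]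
  set a : ℝ × ℝ := (x.1 / (2 * Real.pi), x.2 / (2 * Real.pi)) with ha
  set n : ℤ × ℤ → ℝ := fun k => (a.1 + k.1) ^ 2 + (a.2 + k.2) ^ 2 with hn
  have hrn : ∀ m, rad x m ^ 2 = (2 * Real.pi) ^ 2 * n m := fun m => rad_sq x m
  have hn0 : ∀ m, 0 ≤ n m := fun m => by simp only [hn]; positivity
  have hnr : ∀ m m', rad x m ≤ rad x m' → n m ≤ n m' := by
    intro m m' h
    have := pow_le_pow_left₀ (rad_nonneg _ _) h 2
    rw [hrn, hrn] at this
    exact le_of_mul_le_mul_left this (by positivity)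
  set K := C * (c ^ (-(2 : ℝ)) + 1) ^ (1 / 3 : ℝ) with hK
  have hrow : ∀ m, ∀ S : Finset (ℤ × ℤ), ∑ m' ∈ S, pairKernel x (m, m')
      ≤ K * rad x m ^ (-(7 / 3) : ℝ) := by
    intro m S
    have hrm : 0 < rad x m := hc.trans_le (hr m)
    have h1 : ∑ m' ∈ S, pairKernel x (m, m') ≤
        rad x m ^ (-3 : ℝ) * ∑ m' ∈ S with rad x m ≤ rad x m',
          (1 + (n m' - n m)) ^ (-(3 / 2) : ℝ) := by
      rw [Finset.sum_filter, Finset.mul_sum]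
      refine Finset.sum_le_sum fun m' _ => ?_
      unfold pairKernel
      simp only
      split_ifs with h
      · have hle := hnr m m' h
        gcongr ?_ * ?_
        apply Real.rpow_le_rpow_of_nonpos (by linarith) _ (by norm_num)
        rw [hrn, hrn]
        nlinarith
      · simp
    refine h1.trans ?_
    have h2 := hb a (n m) (hn0 m) {m' ∈ S | rad x m ≤ rad x m'} (by
      intro k hk
      exact hnr m k (Finset.mem_filter.1 hk).2)
    have h3 : (1 + n m) ^ (1 / 3 : ℝ) ≤ (c ^ (-(2 : ℝ)) + 1) ^ (1 / 3 : ℝ) * rad x m ^ (2 / 3 : ℝ) := by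
      have e : rad x m ^ (2 / 3 : ℝ) = (rad x m ^ 2) ^ (1 / 3 : ℝ) := by
        rw [← Real.rpow_natCast, ← Real.rpow_mul hrm.le]; norm_num
      rw [e, ← Real.mul_rpow (by positivity) (by positivity)]
      refine Real.rpow_le_rpow (by linarith [hn0 m]) ?_ (by norm_num)
      have e1 : c ^ (-(2 : ℝ)) = (c ^ 2)⁻¹ := by
        rw [Real.rpow_neg hc.le]; norm_num
      rw [e1, add_mul]
      have e2 : 1 ≤ (c ^ 2)⁻¹ * rad x m ^ 2 := by
        rw [inv_mul_eq_div, le_div_iff₀ (by positivity), one_mul]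
        exact pow_le_pow_left₀ hc.le (hr m) 2
      have := hrn m
      nlinarith [hn0 m]
    calc rad x m ^ (-3 : ℝ) * ∑ m' ∈ S with rad x m ≤ rad x m',
          (1 + (n m' - n m)) ^ (-(3 / 2) : ℝ)
        ≤ rad x m ^ (-3 : ℝ) * (C * ((c ^ (-(2 : ℝ)) + 1) ^ (1 / 3 : ℝ) * rad x m ^ (2 / 3 : ℝ))) := by
          gcongr
          exact h2.trans (by gcongr)
      _ = K * (rad x m ^ (-3 : ℝ) * rad x m ^ (2 / 3 : ℝ)) := by rw [hK]; ring
      _ = _ := by rw [← Real.rpow_add hrm]; norm_num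
  have hrow_summable : ∀ m, Summable fun m' => pairKernel x (m, m') := fun m =>
    summable_of_sum_le (fun _ => pairKernel_nonneg _ _) (hrow m)
  rw [summable_prod_of_nonneg (fun q => pairKernel_nonneg x q)]
  refine ⟨hrow_summable, ?_⟩
  refine Summable.of_nonneg_of_le (fun m => tsum_nonneg fun _ => pairKernel_nonneg _ _)
    (fun m => (hrow_summable m).tsum_le_of_sum_le (hrow m))
    ((summable_rad_rpow hx (by norm_num : (2 : ℝ) < 7 / 3)).mul_left K)

lemma pair_weight_le {r r' T : ℝ} (hr : 0 < r) (hrr : r ≤ r') (hT : 0 < T) :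
    (r ^ (-(3 / 2) : ℝ) * min 1 (T / r) ^ (3 / 2 : ℝ)) *
      (r' ^ (-(3 / 2) : ℝ) * min 1 (T / r') ^ (3 / 2 : ℝ)) * Real.exp (-(T ^ 2 * (r - r') ^ 2 / 4))
      ≤ 16 * (r ^ (-3 : ℝ) * (1 + (r' ^ 2 - r ^ 2)) ^ (-(3 / 2) : ℝ)) := by
  have hr' : 0 < r' := hr.trans_le hrr
  set β := min 1 (T / r) with hβ
  have hβ0 : 0 < β := lt_min one_pos (by positivity)
  have hβ1 : β ≤ 1 := min_le_left _ _
  have h1 : min 1 (T / r') ≤ β := min_le_min_left _ (by gcongr)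
  have h0 : 0 < min 1 (T / r') := lt_min one_pos (by positivity)
  have hβ2 : β ^ (3 / 2 : ℝ) * min 1 (T / r') ^ (3 / 2 : ℝ) ≤ β ^ 2 := by
    calc β ^ (3 / 2 : ℝ) * min 1 (T / r') ^ (3 / 2 : ℝ) ≤ β ^ (3 / 2 : ℝ) * β ^ (3 / 2 : ℝ) := by
          gcongr
      _ = β ^ (3 : ℝ) := by rw [← Real.rpow_add hβ0]; norm_num
      _ ≤ β ^ (2 : ℝ) := Real.rpow_le_rpow_of_exponent_ge hβ0 hβ1 (by norm_num)
      _ = β ^ 2 := by norm_num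
  set y := r' ^ 2 - r ^ 2 with hy
  have hy0 : 0 ≤ y := by
    have := pow_le_pow_left₀ hr.le hrr 2
    linarith
  set θ := r / (4 * r') with hθ
  have hθ0 : 0 < θ := by positivity
  have hθ1 : θ ≤ 1 / 4 := by
    rw [hθ, div_le_iff₀ (by positivity)]; linarith
  have hexp : Real.exp (-(T ^ 2 * (r - r') ^ 2 / 4)) ≤ (1 + T ^ 2 * (r - r') ^ 2 / 4)⁻¹ := by
    rw [Real.exp_neg]
    apply inv_anti₀ (by positivity)
    linarith [Real.add_one_le_exp (T ^ 2 * (r - r') ^ 2 / 4)]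
  have hq : β ^ 2 * (1 + θ ^ 2 * y ^ 2) ≤ 1 + T ^ 2 * (r - r') ^ 2 / 4 := by
    have h2 : θ * y ≤ r * (r' - r) / 2 := by
      rw [hθ, hy, div_mul_eq_mul_div, div_le_iff₀ (by positivity)]
      nlinarith [mul_nonneg (mul_nonneg hr.le (sub_nonneg.2 hrr)) (sub_nonneg.2 hrr)]
    have h3 : θ ^ 2 * y ^ 2 ≤ r ^ 2 * (r - r') ^ 2 / 4 := by
      have := pow_le_pow_left₀ (by positivity) h2 2
      calc θ ^ 2 * y ^ 2 = (θ * y) ^ 2 := by ring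
        _ ≤ _ := this
        _ = _ := by ring
    have h4 : β * r ≤ T := by
      calc β * r ≤ T / r * r := by gcongr; exact min_le_right _ _
        _ = T := by field_simp
    have h5 : β ^ 2 * r ^ 2 ≤ T ^ 2 := by
      rw [← mul_pow]; exact pow_le_pow_left₀ (by positivity) h4 2
    have h6 : β ^ 2 ≤ 1 := pow_le_one₀ hβ0.le hβ1
    nlinarith [mul_le_mul_of_nonneg_left h3 (sq_nonneg β),
      mul_le_mul_of_nonneg_right h5 (sq_nonneg (r - r'))]
  have hmain : β ^ 2 * Real.exp (-(T ^ 2 * (r - r') ^ 2 / 4)) ≤ (1 + θ ^ 2 * y ^ 2)⁻¹ := by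
    calc β ^ 2 * Real.exp (-(T ^ 2 * (r - r') ^ 2 / 4))
        ≤ β ^ 2 * (1 + T ^ 2 * (r - r') ^ 2 / 4)⁻¹ := by gcongr
      _ ≤ (1 + θ ^ 2 * y ^ 2)⁻¹ := by
        rw [← div_eq_mul_inv, div_le_iff₀ (by positivity), inv_mul_eq_div,
          le_div_iff₀ (by positivity)]
        exact hq
  have hfin : (1 + θ ^ 2 * y ^ 2)⁻¹ ≤ 2 * (θ ^ (-(3 / 2) : ℝ) * (1 + y) ^ (-(3 / 2) : ℝ)) := by
    have hb : (θ * (1 + y)) ^ 2 / 2 ≤ 1 + θ ^ 2 * y ^ 2 := by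
      have : θ ^ 2 ≤ 1 := by nlinarith
      nlinarith [mul_nonneg (sq_nonneg θ) (sq_nonneg (1 - y))]
    calc (1 + θ ^ 2 * y ^ 2)⁻¹ = (1 + θ ^ 2 * y ^ 2) ^ (-1 : ℝ) := (Real.rpow_neg_one _).symm
      _ ≤ (1 + θ ^ 2 * y ^ 2) ^ (-(3 / 4) : ℝ) :=
        Real.rpow_le_rpow_of_exponent_le (by nlinarith [mul_nonneg (sq_nonneg θ) (sq_nonneg y)])
          (by norm_num)
      _ ≤ ((θ * (1 + y)) ^ 2 / 2) ^ (-(3 / 4) : ℝ) :=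
        Real.rpow_le_rpow_of_nonpos (by positivity) hb (by norm_num)
      _ = 2 ^ (3 / 4 : ℝ) * (θ ^ (-(3 / 2) : ℝ) * (1 + y) ^ (-(3 / 2) : ℝ)) := by
        rw [Real.div_rpow (by positivity) (by norm_num), ← Real.rpow_natCast,
          ← Real.rpow_mul (by positivity), Real.mul_rpow (by positivity) (by positivity),
          Real.rpow_neg (x := 2) (by norm_num), div_inv_eq_mul]
        norm_num
        ring
      _ ≤ 2 * (θ ^ (-(3 / 2) : ℝ) * (1 + y) ^ (-(3 / 2) : ℝ)) := by
        gcongr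
        calc (2 : ℝ) ^ (3 / 4 : ℝ) ≤ 2 ^ (1 : ℝ) :=
              Real.rpow_le_rpow_of_exponent_le (by norm_num) (by norm_num)
          _ = 2 := Real.rpow_one 2
  have hθe : θ ^ (-(3 / 2) : ℝ) = 8 * (r ^ (-(3 / 2) : ℝ) * r' ^ (3 / 2 : ℝ)) := by
    rw [hθ, Real.div_rpow hr.le (by positivity), Real.mul_rpow (by norm_num) hr'.le,
      Real.rpow_neg hr'.le, Real.rpow_neg (x := 4) (by norm_num)]
    have : (4 : ℝ) ^ (3 / 2 : ℝ) = 8 := by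
      rw [show (4 : ℝ) = 2 ^ (2 : ℝ) by norm_num, ← Real.rpow_mul (by norm_num)]; norm_num
    rw [this]
    field_simp
  have hr3 : r ^ (-3 : ℝ) = r ^ (-(3 / 2) : ℝ) * r ^ (-(3 / 2) : ℝ) := by
    rw [← Real.rpow_add hr]; norm_num
  have hr1 : r' ^ (-(3 / 2) : ℝ) * r' ^ (3 / 2 : ℝ) = 1 := by
    rw [← Real.rpow_add hr']; norm_num
  calc _ = (r ^ (-(3 / 2) : ℝ) * r' ^ (-(3 / 2) : ℝ)) *
        ((β ^ (3 / 2 : ℝ) * min 1 (T / r') ^ (3 / 2 : ℝ)) *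
          Real.exp (-(T ^ 2 * (r - r') ^ 2 / 4))) := by ring
    _ ≤ (r ^ (-(3 / 2) : ℝ) * r' ^ (-(3 / 2) : ℝ)) *
        (β ^ 2 * Real.exp (-(T ^ 2 * (r - r') ^ 2 / 4))) := by gcongr
    _ ≤ (r ^ (-(3 / 2) : ℝ) * r' ^ (-(3 / 2) : ℝ)) *
        (2 * (θ ^ (-(3 / 2) : ℝ) * (1 + y) ^ (-(3 / 2) : ℝ))) := by
        exact mul_le_mul_of_nonneg_left (hmain.trans hfin) (by positivity)
    _ = _ := by
        rw [hθe, hr3]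
        linear_combination (16 * r ^ (-(3 / 2) : ℝ) * r ^ (-(3 / 2) : ℝ) *
          (1 + y) ^ (-(3 / 2) : ℝ)) * hr1

/-- The Fourier transform of the unit disc, as a function of the length of the frequency. -/
noncomputable def discFT (z : ℝ) : ℝ := 2 * ∫ v in (-1 : ℝ)..1, Real.sqrt (1 - v ^ 2) * Real.cos (z * v)

/-- The integral over the vertical side of the contour. -/
noncomputable def sideFun (z : ℝ) (y : ℝ) : ℂ :=
  ((y : ℂ) ^ 2 - 2 * Complex.I * y) ^ (1 / 2 : ℂ) * (Real.exp (-(z * y)) : ℂ)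

lemma cpow_half_sq (w : ℂ) : (w ^ (1 / 2 : ℂ)) ^ 2 = w := by
  rw [one_div]
  exact Complex.cpow_nat_inv_pow w two_ne_zero

lemma cpow_half_re_nonneg (w : ℂ) : 0 ≤ (w ^ (1 / 2 : ℂ)).re := by
  rcases eq_or_ne w 0 with rfl | hw
  · simp
  have h := Complex.cpow_ofReal_re w (1 / 2)
  have e : ((1 / 2 : ℝ) : ℂ) = 1 / 2 := by push_cast; rfl
  rw [e] at h
  rw [h]
  refine mul_nonneg (by positivity) (Real.cos_nonneg_of_mem_Icc ⟨?_, ?_⟩)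
  · linarith [Complex.neg_pi_lt_arg w]
  · linarith [Complex.arg_le_pi w]

lemma sideFun_sub_le {z y : ℝ} (hy : 0 < y) :
    ‖sideFun z y - (1 - Complex.I) * ((y ^ (1 / 2 : ℝ) * Real.exp (-(z * y)) : ℝ) : ℂ)‖
      ≤ y ^ (3 / 2 : ℝ) * Real.exp (-(z * y)) := by
  set S := ((y : ℂ) ^ 2 - 2 * Complex.I * y) ^ (1 / 2 : ℂ) with hS
  have hS2 : S ^ 2 = (y : ℂ) ^ 2 - 2 * Complex.I * y := cpow_half_sq _
  have hSre : 0 ≤ S.re := cpow_half_re_nonneg _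
  set q : ℝ := y ^ (1 / 2 : ℝ) with hq
  have hq0 : 0 < q := by positivity
  have hq2 : q ^ 2 = y := by
    rw [hq, ← Real.rpow_natCast, ← Real.rpow_mul hy.le]; norm_num
  have hq2c : (q : ℂ) ^ 2 = y := by exact_mod_cast hq2
  have hprod : (S - (1 - Complex.I) * q) * (S + (1 - Complex.I) * q) = (y : ℂ) ^ 2 := by
    have : (S - (1 - Complex.I) * q) * (S + (1 - Complex.I) * q)
        = S ^ 2 - (1 - 2 * Complex.I + Complex.I ^ 2) * (q : ℂ) ^ 2 := by ring
    rw [this, hS2, hq2c, Complex.I_sq]; ring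
  have hlow : q ≤ ‖S + (1 - Complex.I) * q‖ := by
    refine le_trans ?_ (Complex.re_le_norm _)
    simp
    exact hSre
  have hnorm : ‖S - (1 - Complex.I) * q‖ * ‖S + (1 - Complex.I) * q‖ = y ^ 2 := by
    rw [← norm_mul, hprod, norm_pow, Complex.norm_real, Real.norm_of_nonneg hy.le]
  have h3 : y ^ (3 / 2 : ℝ) * q = y ^ 2 := by
    rw [hq, ← Real.rpow_add hy]; norm_num
  have hmain : ‖S - (1 - Complex.I) * q‖ ≤ y ^ (3 / 2 : ℝ) := by
    refine le_of_mul_le_mul_right ?_ hq0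
    rw [h3, ← hnorm]
    exact mul_le_mul_of_nonneg_left hlow (norm_nonneg _)
  have : sideFun z y - (1 - Complex.I) * ((q * Real.exp (-(z * y)) : ℝ) : ℂ)
      = (S - (1 - Complex.I) * q) * (Real.exp (-(z * y)) : ℂ) := by
    unfold sideFun
    push_cast
    ring
  rw [this, norm_mul, Complex.norm_real, Real.norm_of_nonneg (Real.exp_pos _).le]
  gcongr

lemma continuousOn_sideFun (z : ℝ) : ContinuousOn (sideFun z) (Set.Ici 0) := by
  intro y hy
  unfold sideFun
  refine ContinuousAt.continuousWithinAt ?_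
  refine ContinuousAt.mul ?_ (by fun_prop)
  have h : ContinuousAt (fun w : ℂ => w ^ (1 / 2 : ℂ)) ((y : ℂ) ^ 2 - 2 * Complex.I * y) := by
    refine Complex.continuousAt_cpow_const_of_re_pos (Or.inl ?_) (by norm_num)
    simp [pow_two]
    exact mul_self_nonneg y
  exact ContinuousAt.comp (f := fun y : ℝ => (y : ℂ) ^ 2 - 2 * Complex.I * y) h (by fun_prop)

lemma integrableOn_rpow_mul_exp_neg {s z : ℝ} (hs : -1 < s) (hz : 0 < z) :
    IntegrableOn (fun y : ℝ => y ^ s * Real.exp (-(z * y))) (Set.Ioi 0) := by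
  have := integrableOn_rpow_mul_exp_neg_mul_rpow hs one_pos hz
  simpa using this

lemma integral_rpow_mul_exp_neg {s z : ℝ} (hs : 0 < s) (hz : 0 < z) :
    ∫ y in Set.Ioi (0 : ℝ), y ^ (s - 1) * Real.exp (-(z * y)) = z ^ (-s) * Real.Gamma s := by
  rw [Real.integral_rpow_mul_exp_neg_mul_Ioi hs hz, one_div, Real.inv_rpow hz.le,
    Real.rpow_neg hz.le]

lemma integrableOn_sideFun {z : ℝ} (hz : 0 < z) : IntegrableOn (sideFun z) (Set.Ioi 0) := by
  have hmeas : AEStronglyMeasurable (sideFun z) (volume.restrict (Set.Ioi 0)) :=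
    ((continuousOn_sideFun z).mono Set.Ioi_subset_Ici_self).aestronglyMeasurable
      measurableSet_Ioi
  have h1 := (integrableOn_rpow_mul_exp_neg (s := 3 / 2) (by norm_num) hz)
  have h2 := (integrableOn_rpow_mul_exp_neg (s := 1 / 2) (by norm_num) hz)
  have h3 : IntegrableOn (fun y : ℝ => (1 - Complex.I) *
      ((y ^ (1 / 2 : ℝ) * Real.exp (-(z * y)) : ℝ) : ℂ)) (Set.Ioi 0) :=
    (Integrable.ofReal h2).const_mul _
  have h4 : IntegrableOn (fun y => sideFun z y - (1 - Complex.I) *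
      ((y ^ (1 / 2 : ℝ) * Real.exp (-(z * y)) : ℝ) : ℂ)) (Set.Ioi 0) := by
    refine Integrable.mono' h1 (hmeas.sub h3.aestronglyMeasurable) ?_
    filter_upwards [ae_restrict_mem measurableSet_Ioi] with y hy
    exact sideFun_sub_le hy
  have := h4.add h3
  refine this.congr (Eventually.of_forall fun y => ?_)
  simp

lemma integral_sideFun_sub_le {z : ℝ} (hz : 0 < z) :
    ‖(∫ y in Set.Ioi (0 : ℝ), sideFun z y) -
      (1 - Complex.I) * ((z ^ (-(3 / 2) : ℝ) * (Real.sqrt π / 2) : ℝ) : ℂ)‖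
      ≤ z ^ (-(5 / 2) : ℝ) * Real.Gamma (5 / 2) := by
  have h2 := (integrableOn_rpow_mul_exp_neg (s := 1 / 2) (by norm_num) hz)
  have h3 : IntegrableOn (fun y : ℝ => (1 - Complex.I) *
      ((y ^ (1 / 2 : ℝ) * Real.exp (-(z * y)) : ℝ) : ℂ)) (Set.Ioi 0) :=
    (Integrable.ofReal h2).const_mul _
  have e1 : z ^ (-(3 / 2) : ℝ) * (Real.sqrt π / 2)
      = ∫ y in Set.Ioi (0 : ℝ), y ^ (1 / 2 : ℝ) * Real.exp (-(z * y)) := by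
    have h := integral_rpow_mul_exp_neg (s := 3 / 2) (by norm_num) hz
    have hG : Real.Gamma (3 / 2) = Real.sqrt π / 2 := by
      have := Real.Gamma_add_one (s := 1 / 2) (by norm_num)
      rw [Real.Gamma_one_half_eq] at this
      rw [show (3 / 2 : ℝ) = 1 / 2 + 1 by norm_num, this]; ring
    rw [hG] at h
    rw [← h]
    norm_num
  have e2 : z ^ (-(5 / 2) : ℝ) * Real.Gamma (5 / 2)
      = ∫ y in Set.Ioi (0 : ℝ), y ^ (3 / 2 : ℝ) * Real.exp (-(z * y)) := by
    rw [← integral_rpow_mul_exp_neg (s := 5 / 2) (by norm_num) hz]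
    norm_num
  rw [e1, ← integral_complex_ofReal, ← integral_const_mul, ← integral_sub (integrableOn_sideFun hz) h3, e2]
  refine norm_integral_le_of_norm_le (integrableOn_rpow_mul_exp_neg (by norm_num) hz) ?_
  filter_upwards [ae_restrict_mem measurableSet_Ioi] with y hy
  exact sideFun_sub_le hy

/-- The integrand of the contour integral. -/
noncomputable def contourFun (z : ℝ) (w : ℂ) : ℂ :=
  (1 - w ^ 2) ^ (1 / 2 : ℂ) * Complex.exp (Complex.I * z * w)

lemma contourFun_ofReal (z : ℝ) {v : ℝ} (hv : v ^ 2 ≤ 1) :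
    contourFun z v = (Real.sqrt (1 - v ^ 2) : ℂ) * Complex.exp (Complex.I * (z * v : ℝ)) := by
  unfold contourFun
  have : (1 - (v : ℂ) ^ 2) ^ (1 / 2 : ℂ) = (Real.sqrt (1 - v ^ 2) : ℂ) := by
    rw [Real.sqrt_eq_rpow, Complex.ofReal_cpow (by linarith)]
    push_cast; rfl
  rw [this]; push_cast; ring_nf

lemma contourFun_one_add (z y : ℝ) :
    contourFun z (1 + y * Complex.I) = Complex.exp (Complex.I * z) * sideFun z y := by
  unfold contourFun sideFun
  have e1 : 1 - (1 + (y : ℂ) * Complex.I) ^ 2 = (y : ℂ) ^ 2 - 2 * Complex.I * y := by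
    ring_nf; rw [Complex.I_sq]; ring
  have e2 : Complex.I * z * (1 + (y : ℂ) * Complex.I) = Complex.I * z + ((-(z * y) : ℝ) : ℂ) := by
    push_cast; ring_nf; rw [Complex.I_sq]; ring
  rw [e1, e2, Complex.exp_add, Complex.ofReal_exp]; ring

lemma contourFun_neg_one_add (z y : ℝ) :
    contourFun z (-1 + y * Complex.I)
      = (starRingEnd ℂ) (contourFun z (1 + y * Complex.I)) := by
  unfold contourFun
  rw [map_mul, ← Complex.exp_conj]
  have e1 : 1 - (-1 + (y : ℂ) * Complex.I) ^ 2
      = (starRingEnd ℂ) (1 - (1 + (y : ℂ) * Complex.I) ^ 2) := by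
    simp
    ring
  have harg : (1 - (1 + (y : ℂ) * Complex.I) ^ 2).arg ≠ π := by
    intro h
    have := (Complex.arg_eq_pi_iff.1 h).1
    simp [pow_two] at this
    nlinarith
  have e3 : (starRingEnd ℂ) (1 / 2 : ℂ) = 1 / 2 := by
    simpa using Complex.conj_ofReal (1 / 2)
  rw [e1]
  congr 1
  · rw [Complex.conj_cpow _ _ harg, e3]
  · congr 1
    simp
    ring

lemma continuousOn_contourFun (z H : ℝ) (hH : 0 ≤ H) :
    ContinuousOn (contourFun z) (Set.uIcc (-1) 1 ×ℂ Set.uIcc 0 H) := by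
  intro w hw
  rw [Complex.mem_reProdIm, Set.uIcc_of_le (by norm_num), Set.uIcc_of_le hH] at hw
  refine ContinuousAt.continuousWithinAt ?_
  unfold contourFun
  refine ContinuousAt.mul ?_ (by fun_prop)
  have h : ContinuousAt (fun w : ℂ => w ^ (1 / 2 : ℂ)) (1 - w ^ 2) := by
    refine Complex.continuousAt_cpow_const_of_re_pos (Or.inl ?_) (by norm_num)
    simp [pow_two]
    nlinarith [hw.1.1, hw.1.2, hw.2.1]
  exact ContinuousAt.comp (f := fun w : ℂ => 1 - w ^ 2) h (by fun_prop)

lemma differentiableOn_contourFun (z H : ℝ) :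
    DifferentiableOn ℂ (contourFun z) (Set.Ioo (-1) 1 ×ℂ Set.Ioo 0 H) := by
  intro w hw
  rw [Complex.mem_reProdIm] at hw
  refine DifferentiableAt.differentiableWithinAt ?_
  unfold contourFun
  refine DifferentiableAt.mul ?_ (by fun_prop)
  refine DifferentiableAt.cpow_const (by fun_prop) (Or.inl ?_)
  simp [pow_two]
  nlinarith [hw.1.1, hw.1.2, hw.2.1]

lemma norm_contourFun_le (z : ℝ) {v H : ℝ} (hv : |v| ≤ 1) (hH : 0 ≤ H) :
    ‖contourFun z (v + H * Complex.I)‖ ≤ (2 + H) * Real.exp (-(z * H)) := by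
  unfold contourFun
  rw [norm_mul, Complex.norm_exp]
  have e : (Complex.I * z * (v + H * Complex.I)).re = -(z * H) := by
    simp
  rw [e]
  gcongr
  set w := (v : ℂ) + H * Complex.I with hw
  have h1 : ‖(1 - w ^ 2) ^ (1 / 2 : ℂ)‖ ^ 2 = ‖1 - w ^ 2‖ := by
    rw [← norm_pow, cpow_half_sq]
  have h2 : ‖w‖ ≤ 1 + H := by
    refine (norm_add_le _ _).trans ?_
    rw [norm_mul, Complex.norm_I, mul_one, Complex.norm_real, Complex.norm_real,
      Real.norm_eq_abs, Real.norm_eq_abs, abs_of_nonneg hH]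
    linarith
  have h3 : ‖1 - w ^ 2‖ ≤ (2 + H) ^ 2 := by
    refine (norm_sub_le _ _).trans ?_
    rw [norm_one, norm_pow]
    nlinarith [norm_nonneg w]
  rw [← h1] at h3
  exact le_of_sq_le_sq h3 (by linarith)

lemma integral_contourFun_eq {z : ℝ} (hz : 0 < z) :
    ∫ v in (-1 : ℝ)..1, contourFun z v =
      ((2 * (Complex.exp (Complex.I * z) * ∫ y in Set.Ioi (0 : ℝ), sideFun z y).im : ℝ) : ℂ) := by
  set A := Complex.exp (Complex.I * z) * ∫ y in Set.Ioi (0 : ℝ), sideFun z y with hA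
  have hlimA : Tendsto (fun H : ℝ => ∫ y in (0 : ℝ)..H, contourFun z (1 + y * Complex.I)) atTop
      (nhds A) := by
    have := (intervalIntegral_tendsto_integral_Ioi 0 (integrableOn_sideFun hz) tendsto_id).const_mul
      (Complex.exp (Complex.I * z))
    refine this.congr fun H => ?_
    rw [← intervalIntegral.integral_const_mul]
    simp only [contourFun_one_add, id]
  have hlimB : Tendsto (fun H : ℝ => ∫ y in (0 : ℝ)..H, contourFun z (-1 + y * Complex.I)) atTop
      (nhds ((starRingEnd ℂ) A)) := by
    have := (Complex.continuous_conj.tendsto A).comp hlimA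
    refine this.congr' ?_
    filter_upwards [eventually_ge_atTop 0] with H hH
    simp only [Function.comp]
    rw [intervalIntegral.integral_of_le hH, intervalIntegral.integral_of_le hH, ← integral_conj]
    refine setIntegral_congr_fun measurableSet_Ioc fun y _ => ?_
    exact (contourFun_neg_one_add z y).symm
  have hlimT : Tendsto (fun H : ℝ => ∫ v in (-1 : ℝ)..1, contourFun z (v + H * Complex.I)) atTop
      (nhds 0) := by
    have hexp : Tendsto (fun H : ℝ => (2 + H) * Real.exp (-(z * H)) * 2) atTop (nhds 0) := by
      have h1 := (Real.tendsto_pow_mul_exp_neg_atTop_nhds_zero 0).comp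
        (tendsto_id.const_mul_atTop hz)
      have h2 := (Real.tendsto_pow_mul_exp_neg_atTop_nhds_zero 1).comp
        (tendsto_id.const_mul_atTop hz)
      have := ((h1.const_mul 2).add (h2.const_mul z⁻¹)).mul_const 2
      simp only [mul_zero, add_zero, zero_mul] at this
      refine this.congr fun H => ?_
      simp only [Function.comp, id, pow_zero, pow_one, one_mul]
      field_simp
    refine squeeze_zero_norm' ?_ hexp
    filter_upwards [eventually_ge_atTop 0] with H hH
    have := intervalIntegral.norm_integral_le_of_norm_le_const (a := -1) (b := 1)
      (f := fun v : ℝ => contourFun z (v + H * Complex.I)) (C := (2 + H) * Real.exp (-(z * H))) (by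
        intro v hv
        rw [Set.uIoc_of_le (by norm_num)] at hv
        exact norm_contourFun_le z (abs_le.2 ⟨hv.1.le, hv.2⟩) hH)
    norm_num at this
    exact this
  have hrect : ∀ H : ℝ, 0 ≤ H → (∫ v in (-1 : ℝ)..1, contourFun z v)
      = (∫ v in (-1 : ℝ)..1, contourFun z (v + H * Complex.I))
        - Complex.I * (∫ y in (0 : ℝ)..H, contourFun z (1 + y * Complex.I))
        + Complex.I * ∫ y in (0 : ℝ)..H, contourFun z (-1 + y * Complex.I) := by
    intro H hH
    have := Complex.integral_boundary_rect_eq_zero_of_continuousOn_of_differentiableOn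
      (contourFun z) (-1) (1 + H * Complex.I)
      (by simpa using continuousOn_contourFun z H hH)
      (by simpa [hH] using differentiableOn_contourFun z H)
    simp at this
    linear_combination this
  have hlim := ((hlimT.sub (hlimA.const_mul Complex.I)).add (hlimB.const_mul Complex.I))
  have hconst : Tendsto (fun _ : ℝ => ∫ v in (-1 : ℝ)..1, contourFun z v) atTop
      (nhds (0 - Complex.I * A + Complex.I * (starRingEnd ℂ) A)) := by
    refine hlim.congr' ?_
    filter_upwards [eventually_ge_atTop 0] with H hH
    exact (hrect H hH).symm
  rw [tendsto_nhds_unique tendsto_const_nhds hconst]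
  apply Complex.ext
  · simp; ring
  · simp

lemma discFT_eq_im {z : ℝ} (hz : 0 < z) : discFT z =
    4 * (Complex.exp (Complex.I * z) * ∫ y in Set.Ioi (0 : ℝ), sideFun z y).im := by
  have h := congrArg Complex.re (integral_contourFun_eq hz)
  rw [Complex.ofReal_re] at h
  have h2 : (∫ v in (-1 : ℝ)..1, contourFun z v).re
      = ∫ v in (-1 : ℝ)..1, Real.sqrt (1 - v ^ 2) * Real.cos (z * v) := by
    have hcongr : ∫ v in (-1 : ℝ)..1, contourFun z v = ∫ v in (-1 : ℝ)..1,
        (Real.sqrt (1 - v ^ 2) : ℂ) * Complex.exp (Complex.I * (z * v : ℝ)) := by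
      refine intervalIntegral.integral_congr fun v hv => ?_
      rw [Set.uIcc_of_le (by norm_num)] at hv
      exact contourFun_ofReal z (by nlinarith [hv.1, hv.2])
    rw [hcongr]
    have hint : IntervalIntegrable (fun v : ℝ =>
        (Real.sqrt (1 - v ^ 2) : ℂ) * Complex.exp (Complex.I * (z * v : ℝ))) volume (-1) 1 :=
      Continuous.intervalIntegrable (by fun_prop) _ _
    have := Complex.reCLM.intervalIntegral_comp_comm hint
    simp only [Complex.reCLM_apply] at this
    rw [← this]
    refine intervalIntegral.integral_congr fun v _ => ?_
    simp [mul_comm Complex.I, Complex.exp_ofReal_mul_I_re, -Complex.ofReal_mul]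
  unfold discFT
  rw [← h2, h]; ring

lemma abs_discFT_sub_le {z : ℝ} (hz : 0 < z) :
    |discFT z - 2 * Real.sqrt (2 * π) * z ^ (-(3 / 2) : ℝ) * Real.sin (z - π / 4)|
      ≤ 4 * Real.Gamma (5 / 2) * z ^ (-(5 / 2) : ℝ) := by
  set Y := ∫ y in Set.Ioi (0 : ℝ), sideFun z y with hY
  have hmain : 2 * Real.sqrt (2 * π) * z ^ (-(3 / 2) : ℝ) * Real.sin (z - π / 4)
      = 4 * (Complex.exp (Complex.I * z) *
        ((1 - Complex.I) * ((z ^ (-(3 / 2) : ℝ) * (Real.sqrt π / 2) : ℝ) : ℂ))).im := by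
    rw [mul_comm Complex.I, Complex.exp_mul_I, ← Complex.ofReal_cos, ← Complex.ofReal_sin,
      Real.sin_sub, Real.cos_pi_div_four, Real.sin_pi_div_four, Real.sqrt_mul (by norm_num)]
    have h2 : Real.sqrt 2 * Real.sqrt 2 = 2 := Real.mul_self_sqrt (by norm_num)
    simp only [Complex.mul_im, Complex.mul_re, Complex.add_re, Complex.add_im, Complex.sub_re,
      Complex.sub_im, Complex.ofReal_re, Complex.ofReal_im, Complex.I_re, Complex.I_im,
      Complex.one_re, Complex.one_im]
    linear_combination (Real.sqrt π * z ^ (-(3 / 2) : ℝ) * (Real.sin z - Real.cos z)) * h2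
  rw [discFT_eq_im hz, hmain, ← mul_sub, ← Complex.sub_im, ← mul_sub, abs_mul]
  have h1 : |(Complex.exp (Complex.I * z) * (Y -
      (1 - Complex.I) * ((z ^ (-(3 / 2) : ℝ) * (Real.sqrt π / 2) : ℝ) : ℂ))).im|
      ≤ z ^ (-(5 / 2) : ℝ) * Real.Gamma (5 / 2) := by
    refine (Complex.abs_im_le_norm _).trans ?_
    rw [norm_mul, mul_comm Complex.I, Complex.norm_exp_ofReal_mul_I, one_mul]
    exact integral_sideFun_sub_le hz
  rw [abs_of_pos (by norm_num : (0 : ℝ) < 4)]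
  nlinarith [h1]

lemma abs_discFT_le (z : ℝ) : |discFT z| ≤ 4 := by
  unfold discFT
  rw [abs_mul, abs_of_pos (by norm_num : (0 : ℝ) < 2)]
  have := intervalIntegral.norm_integral_le_of_norm_le_const (a := -1) (b := 1)
    (f := fun v : ℝ => Real.sqrt (1 - v ^ 2) * Real.cos (z * v)) (C := 1) (by
      intro v hv
      rw [norm_mul]
      refine mul_le_one₀ ?_ (norm_nonneg _) (Real.abs_cos_le_one _)
      rw [Real.norm_of_nonneg (Real.sqrt_nonneg _), Real.sqrt_le_left (by norm_num)]
      nlinarith [sq_nonneg v])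
  norm_num at this
  linarith

lemma continuous_discFT : Continuous discFT := by
  unfold discFT
  refine continuous_const.mul ?_
  exact intervalIntegral.continuous_parametric_intervalIntegral_of_continuous' (by fun_prop) _ _

lemma exists_discFT_decay : ∃ C : ℝ, 0 < C ∧ ∀ z : ℝ, 0 < z →
    |discFT z| ≤ C * min 1 (1 / z) ^ (3 / 2 : ℝ) := by
  have hG : 0 < Real.Gamma (5 / 2) := Real.Gamma_pos_of_pos (by norm_num)
  refine ⟨4 + (2 * Real.sqrt (2 * π) + 4 * Real.Gamma (5 / 2)), by positivity, fun z hz => ?_⟩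
  rcases le_total z 1 with h | h
  · rw [min_eq_left (by rw [le_div_iff₀ hz]; linarith), Real.one_rpow, mul_one]
    have := abs_discFT_le z
    have : 0 ≤ 2 * Real.sqrt (2 * π) := by positivity
    linarith
  · rw [min_eq_right (by rw [div_le_iff₀ hz]; linarith), one_div, Real.inv_rpow hz.le,
      ← Real.rpow_neg hz.le]
    have h1 := abs_discFT_sub_le hz
    have h2 : z ^ (-(5 / 2) : ℝ) ≤ z ^ (-(3 / 2) : ℝ) :=
      Real.rpow_le_rpow_of_exponent_le h (by norm_num)
    have h3 : |2 * Real.sqrt (2 * π) * z ^ (-(3 / 2) : ℝ) * Real.sin (z - π / 4)|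
        ≤ 2 * Real.sqrt (2 * π) * z ^ (-(3 / 2) : ℝ) := by
      rw [abs_mul, abs_of_nonneg (by positivity)]
      exact mul_le_of_le_one_right (by positivity) (Real.abs_sin_le_one _)
    have h4 := abs_sub_abs_le_abs_sub (discFT z)
      (2 * Real.sqrt (2 * π) * z ^ (-(3 / 2) : ℝ) * Real.sin (z - π / 4))
    have h5 : 0 ≤ z ^ (-(3 / 2) : ℝ) := by positivity
    have := mul_le_mul_of_nonneg_left h2 hG.le
    linarith

/-- The open Euclidean disc of radius `ρ` about the origin. -/
def disc (ρ : ℝ) : Set (ℝ × ℝ) := {ξ | nrm2 ξ < ρ}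

lemma continuous_nrm2 : Continuous nrm2 := by unfold nrm2; fun_prop

lemma measurableSet_disc (ρ : ℝ) : MeasurableSet (disc ρ) :=
  (isOpen_lt continuous_nrm2 continuous_const).measurableSet

lemma mem_disc_iff {ρ : ℝ} (hρ : 0 < ρ) (ξ : ℝ × ℝ) : ξ ∈ disc ρ ↔ ξ.1 ^ 2 + ξ.2 ^ 2 < ρ ^ 2 :=
  Real.sqrt_lt' hρ

lemma nrm2_eq_norm (a : ℝ × ℝ) : nrm2 a = ‖(⟨a.1, a.2⟩ : ℂ)‖ := by
  rw [nrm2, Complex.norm_def, Complex.normSq_mk]; ring_nf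

lemma abs_fst_le_nrm2 (a : ℝ × ℝ) : |a.1| ≤ nrm2 a := by
  rw [nrm2_eq_norm]; exact Complex.abs_re_le_norm ⟨a.1, a.2⟩

lemma abs_snd_le_nrm2 (a : ℝ × ℝ) : |a.2| ≤ nrm2 a := by
  rw [nrm2_eq_norm]; exact Complex.abs_im_le_norm ⟨a.1, a.2⟩

lemma nrm2_add_le (a b : ℝ × ℝ) : nrm2 (a + b) ≤ nrm2 a + nrm2 b := by
  simp only [nrm2_eq_norm]
  exact norm_add_le (⟨a.1, a.2⟩ : ℂ) ⟨b.1, b.2⟩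

lemma nrm2_neg (a : ℝ × ℝ) : nrm2 (-a) = nrm2 a := by simp [nrm2]

lemma volume_disc_lt_top (ρ : ℝ) : volume (disc ρ) < ⊤ := by
  have hsub : disc ρ ⊆ Metric.closedBall 0 ρ := by
    intro ξ hξ
    rw [mem_closedBall_zero_iff, Prod.norm_def]
    exact max_le ((abs_fst_le_nrm2 ξ).trans (le_of_lt hξ)) ((abs_snd_le_nrm2 ξ).trans (le_of_lt hξ))
  exact (measure_mono hsub).trans_lt measure_closedBall_lt_top

lemma integral_disc_eq_complex {ρ : ℝ} (f : ℝ × ℝ → ℂ) :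
    ∫ ξ in disc ρ, f ξ = ∫ w in {w : ℂ | ‖w‖ < ρ}, f (w.re, w.im) := by
  have h := Complex.volume_preserving_equiv_real_prod.setIntegral_preimage_emb
    Complex.measurableEquivRealProd.measurableEmbedding f (disc ρ)
  rw [← h]
  congr 1
  congr 1
  ext w
  simp [disc, nrm2_eq_norm]

lemma integral_disc_exp_rotate {ρ : ℝ} (y : ℝ × ℝ) :
    ∫ ξ in disc ρ, Complex.exp (Complex.I * (ip2 y ξ : ℂ))
      = ∫ ξ in disc ρ, Complex.exp (Complex.I * ((nrm2 y * ξ.1 : ℝ) : ℂ)) := by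
  rw [integral_disc_eq_complex, integral_disc_eq_complex]
  obtain ⟨u, hu⟩ : ∃ u : Circle, (nrm2 y : ℂ) * u = ⟨y.1, y.2⟩ := by
    refine ⟨Circle.exp (Complex.arg ⟨y.1, y.2⟩), ?_⟩
    rw [nrm2_eq_norm, Circle.coe_exp]
    exact Complex.norm_mul_exp_arg_mul_I _
  have hmp := (rotation u).measurePreserving
  have h := hmp.setIntegral_preimage_emb (rotation u).toHomeomorph.measurableEmbedding
    (fun w : ℂ => Complex.exp (Complex.I * (ip2 y (w.re, w.im) : ℂ))) {w : ℂ | ‖w‖ < ρ}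
  rw [← h]
  have hset : (rotation u) ⁻¹' {w : ℂ | ‖w‖ < ρ} = {w : ℂ | ‖w‖ < ρ} := by
    ext w; simp [Circle.norm_coe]
  rw [hset]
  refine integral_congr_ae (Eventually.of_forall fun w => ?_)
  have h1 := congrArg Complex.re hu
  have h2 := congrArg Complex.im hu
  have hn : (u : ℂ).re ^ 2 + (u : ℂ).im ^ 2 = 1 := by
    have := Circle.normSq_coe u
    rw [Complex.normSq_apply] at this
    linarith
  simp only [Complex.mul_re, Complex.mul_im, Complex.ofReal_re, Complex.ofReal_im, zero_mul,
    sub_zero, add_zero] at h1 h2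
  have key : ip2 y ((rotation u w).re, (rotation u w).im) = nrm2 y * w.re := by
    simp only [ip2, rotation_apply, Complex.mul_re, Complex.mul_im, ← h1, ← h2]
    linear_combination nrm2 y * w.re * hn
  simp only [key]

lemma integral_section {A : ℝ} (c : ℂ) :
    ∫ t : ℝ, (if t ^ 2 < A then c else 0) = (2 * Real.sqrt A : ℝ) * c := by
  have hset : {t : ℝ | t ^ 2 < A} = Set.Ioo (-Real.sqrt A) (Real.sqrt A) := by
    ext t
    exact Real.sq_lt
  have : (fun t : ℝ => if t ^ 2 < A then c else 0)
      = Set.indicator (Set.Ioo (-Real.sqrt A) (Real.sqrt A)) (fun _ => c) := by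
    rw [← hset]
    ext t
    simp [Set.indicator]
  rw [this, integral_indicator measurableSet_Ioo, setIntegral_const, Measure.real,
    Real.volume_Ioo, ENNReal.toReal_ofReal (by linarith [Real.sqrt_nonneg A]), Complex.real_smul]
  congr 2
  ring

lemma integral_sqrt_mul_exp {ρ : ℝ} (hρ : 0 < ρ) (r : ℝ) :
    ∫ s : ℝ, ((2 * Real.sqrt (ρ ^ 2 - s ^ 2) : ℝ) : ℂ) * Complex.exp (Complex.I * ((r * s : ℝ) : ℂ))
      = ((ρ ^ 2 * discFT (ρ * r) : ℝ) : ℂ) := by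
  have h0 : ∀ s : ℝ, s ∉ Set.Ioc (-ρ) ρ →
      ((2 * Real.sqrt (ρ ^ 2 - s ^ 2) : ℝ) : ℂ) * Complex.exp (Complex.I * ((r * s : ℝ) : ℂ)) = 0 := by
    intro s hs
    have : ρ ^ 2 - s ^ 2 ≤ 0 := by
      rw [Set.mem_Ioc, not_and_or, not_lt, not_le] at hs
      rcases hs with h | h <;> nlinarith
    rw [Real.sqrt_eq_zero_of_nonpos this]; simp
  rw [← setIntegral_eq_integral_of_forall_compl_eq_zero h0,
    ← intervalIntegral.integral_of_le (by linarith)]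
  have hsub := intervalIntegral.smul_integral_comp_mul_left (a := -1) (b := 1)
    (fun s : ℝ => ((2 * Real.sqrt (ρ ^ 2 - s ^ 2) : ℝ) : ℂ) *
      Complex.exp (Complex.I * ((r * s : ℝ) : ℂ))) ρ
  rw [mul_neg_one, mul_one] at hsub
  rw [← hsub]
  have hpt : ∀ v : ℝ, ((2 * Real.sqrt (ρ ^ 2 - (ρ * v) ^ 2) : ℝ) : ℂ) *
      Complex.exp (Complex.I * ((r * (ρ * v) : ℝ) : ℂ))
      = ((2 * ρ * (Real.sqrt (1 - v ^ 2) * Real.cos (ρ * r * v)) : ℝ) : ℂ)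
        + ((2 * ρ * (Real.sqrt (1 - v ^ 2) * Real.sin (ρ * r * v)) : ℝ) : ℂ) * Complex.I := by
    intro v
    have e1 : Real.sqrt (ρ ^ 2 - (ρ * v) ^ 2) = ρ * Real.sqrt (1 - v ^ 2) := by
      rw [show ρ ^ 2 - (ρ * v) ^ 2 = ρ ^ 2 * (1 - v ^ 2) by ring, Real.sqrt_mul (by positivity),
        Real.sqrt_sq hρ.le]
    rw [e1, mul_comm Complex.I, Complex.exp_mul_I, ← Complex.ofReal_cos, ← Complex.ofReal_sin,
      show r * (ρ * v) = ρ * r * v by ring]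
    push_cast
    ring
  simp_rw [hpt]
  rw [intervalIntegral.integral_add (Continuous.intervalIntegrable (by fun_prop) _ _)
    (Continuous.intervalIntegrable (by fun_prop) _ _), intervalIntegral.integral_mul_const,
    intervalIntegral.integral_ofReal, intervalIntegral.integral_ofReal,
    intervalIntegral.integral_const_mul, intervalIntegral.integral_const_mul]
  have hodd : ∫ v in (-1 : ℝ)..1, Real.sqrt (1 - v ^ 2) * Real.sin (ρ * r * v) = 0 := by
    have := intervalIntegral.integral_comp_neg (a := -1) (b := 1)
      (fun v : ℝ => Real.sqrt (1 - v ^ 2) * Real.sin (ρ * r * v))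
    simp only [even_two, Even.neg_pow, mul_neg, Real.sin_neg, neg_neg,
      intervalIntegral.integral_neg] at this
    linarith
  rw [hodd, discFT, Complex.real_smul]
  push_cast
  ring

lemma integral_disc_exp {ρ : ℝ} (hρ : 0 < ρ) (y : ℝ × ℝ) :
    ∫ ξ in disc ρ, Complex.exp (Complex.I * (ip2 y ξ : ℂ))
      = ((ρ ^ 2 * discFT (ρ * nrm2 y) : ℝ) : ℂ) := by
  rw [integral_disc_exp_rotate, ← integral_sqrt_mul_exp hρ, ← integral_indicator (measurableSet_disc ρ),
    Measure.volume_eq_prod, integral_prod]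
  · refine integral_congr_ae (Eventually.of_forall fun s => ?_)
    simp only
    rw [← integral_section]
    refine integral_congr_ae (Eventually.of_forall fun t => ?_)
    simp only [Set.indicator, mem_disc_iff hρ, lt_sub_iff_add_lt, add_comm]
  · rw [← Measure.volume_eq_prod, integrable_indicator_iff (measurableSet_disc ρ)]
    refine Measure.integrableOn_of_bounded (M := 1) ?_ (by fun_prop) (Eventually.of_forall fun ξ => ?_)
    · exact (volume_disc_lt_top ρ).ne
    · rw [mul_comm, Complex.norm_exp_ofReal_mul_I]


lemma discFT_zero : discFT 0 = π := by
  simp only [discFT, zero_mul, Real.cos_zero, mul_one, integral_sqrt_one_sub_sq]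
  ring

lemma volume_real_disc {ρ : ℝ} (hρ : 0 < ρ) : volume.real (disc ρ) = π * ρ ^ 2 := by
  have h := integral_disc_exp hρ (0, 0)
  have h0 : nrm2 (0, 0) = 0 := by simp [nrm2]
  simp only [ip2, zero_mul, add_zero, Complex.ofReal_zero, mul_zero, Complex.exp_zero, h0,
    discFT_zero, setIntegral_const, Complex.real_smul, mul_one] at h
  rw [Complex.ofReal_inj] at h
  linarith

section Periodization

/-- The measure on `ℝ / ℤ` is normalised to have total mass one. -/
noncomputable local instance : MeasureSpace UnitAddCircle := ⟨AddCircle.haarAddCircle⟩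

local instance : Measure.IsAddHaarMeasure (volume : Measure UnitAddCircle) :=
  inferInstanceAs (Measure.IsAddHaarMeasure AddCircle.haarAddCircle)

local instance : IsProbabilityMeasure (volume : Measure UnitAddCircle) :=
  inferInstanceAs (IsProbabilityMeasure AddCircle.haarAddCircle)

variable {d : Type*}

section Cube

/-- The inclusion of the integer lattice. -/
def latticeCast (k : d → ℤ) : d → ℝ := fun i => (k i : ℝ)

/-- The standard half-open unit cube. -/
def unitCube (d : Type*) : Set (d → ℝ) := {y | ∀ i, y i ∈ Set.Ioc (0 : ℝ) (0 + 1)}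

lemma sub_latticeCast_mem_unitCube_iff (y : d → ℝ) (k : d → ℤ) :
    y - latticeCast k ∈ unitCube d ↔ k = fun i => ⌈y i⌉ - 1 := by
  simp only [unitCube, Set.mem_ofPred_eq, Pi.sub_apply, latticeCast, Set.mem_Ioc, zero_add,
    funext_iff]
  refine forall_congr' fun i => ?_
  rw [eq_sub_iff_add_eq, eq_comm, Int.ceil_eq_iff]
  push_cast
  constructor <;> rintro ⟨h1, h2⟩ <;> constructor <;> linarith

/-- The representative of a point of the torus in the unit cube. -/
noncomputable def torusRep (t : UnitAddTorus d) : d → ℝ :=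
  (UnitAddTorus.measurableEquivPiIoc (fun _ => (0 : ℝ)) t : d → ℝ)

lemma measurable_torusRep : Measurable (torusRep (d := d)) :=
  measurable_subtype_coe.comp (UnitAddTorus.measurableEquivPiIoc (fun _ : d => (0 : ℝ))).measurable

lemma torusRep_coe {y : d → ℝ} (hy : y ∈ unitCube d) :
    torusRep (fun i => (y i : UnitAddCircle)) = y := by
  have := (UnitAddTorus.measurableEquivPiIoc (fun _ : d => (0 : ℝ))).apply_symm_apply ⟨y, hy⟩
  exact congrArg Subtype.val this

lemma torusRep_coe_eq (y : d → ℝ) :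
    torusRep (fun i => (y i : UnitAddCircle)) = y - latticeCast fun i => ⌈y i⌉ - 1 := by
  rw [← torusRep_coe ((sub_latticeCast_mem_unitCube_iff y _).2 rfl)]
  generalize (fun i => ⌈y i⌉ - 1) = c
  congr 1
  ext i
  have h0 : ((c i : ℝ) : UnitAddCircle) = 0 := by simp
  simp [latticeCast, h0]

end Cube

variable [Fintype d]

lemma norm_latticeCast (k : d → ℤ) : ‖latticeCast k‖ = ‖k‖ := by
  simp only [Pi.norm_def, latticeCast, nnnorm, Int.norm_cast_real]

lemma measurableSet_unitCube : MeasurableSet (unitCube d) :=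
  MeasurableSet.univ_pi' fun _ => measurableSet_Ioc

lemma norm_le_one_of_mem_unitCube {y : d → ℝ} (hy : y ∈ unitCube d) : ‖y‖ ≤ 1 := by
  rw [pi_norm_le_iff_of_nonneg zero_le_one]
  intro i
  rw [Real.norm_eq_abs, abs_le]
  have := hy i
  rw [Set.mem_Ioc] at this
  constructor <;> linarith

lemma integral_eq_sum_unitCube {h : (d → ℝ) → ℂ} (hint : Integrable h) {K : Finset (d → ℤ)}
    (hK : ∀ y, h y ≠ 0 → (fun i => ⌈y i⌉ - 1) ∈ K) :
    ∫ y, h y = ∑ k ∈ K, ∫ y in unitCube d, h (y + latticeCast k) := by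
  classical
  have h1 : ∀ k, ∫ y in unitCube d, h (y + latticeCast k)
      = ∫ y, Set.indicator (unitCube d) (fun _ => (1 : ℂ)) (y - latticeCast k) * h y := by
    intro k
    rw [← integral_indicator measurableSet_unitCube, ← integral_add_right_eq_self (μ := volume)
      (fun y => Set.indicator (unitCube d) (fun _ => (1 : ℂ)) (y - latticeCast k) * h y)
      (latticeCast k)]
    refine integral_congr_ae (Eventually.of_forall fun y => ?_)
    by_cases hy : y ∈ unitCube d <;> simp [Set.indicator, hy]
  simp_rw [h1]
  rw [← integral_finsetSum]
  · refine integral_congr_ae (Eventually.of_forall fun y => ?_)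
    simp only [Set.indicator, sub_latticeCast_mem_unitCube_iff, ite_mul, one_mul, zero_mul,
      Finset.sum_ite_eq']
    split_ifs with hy
    · rfl
    · by_contra hne
      exact hy (hK y hne)
  · intro k _
    refine hint.bdd_mul (c := 1) ?_ (Eventually.of_forall fun y => ?_)
    · exact ((measurable_const.indicator measurableSet_unitCube).comp
        (measurable_id.sub_const _)).aestronglyMeasurable
    · by_cases hy : y - latticeCast k ∈ unitCube d <;> simp [Set.indicator, hy]

variable (d) in
/-- The lattice points of sup norm at most `R`. -/
noncomputable def latticeBall (R : ℝ) : Finset (d → ℤ) :=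
  (isCompact_closedBall (0 : d → ℤ) R).finite_of_discrete.toFinset

lemma mem_latticeBall {R : ℝ} {k : d → ℤ} : k ∈ latticeBall d R ↔ ‖k‖ ≤ R := by
  simp [latticeBall]

lemma norm_ceil_sub_one_le (y : d → ℝ) : ‖fun i => ⌈y i⌉ - 1‖ ≤ ‖y‖ + 1 := by
  rw [pi_norm_le_iff_of_nonneg (by positivity)]
  intro i
  have h := norm_le_pi_norm y i
  rw [Real.norm_eq_abs, abs_le] at h
  rw [Int.norm_eq_abs, abs_le]
  push_cast
  have h1 := Int.le_ceil (y i)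
  have h2 := Int.ceil_lt_add_one (y i)
  constructor <;> linarith

/-- Bounded measurable functions on `ℝᵈ` supported in the ball of radius `R`. -/
structure BoundedSupport (f : (d → ℝ) → ℂ) (R : ℝ) : Prop where
  measurable : Measurable f
  norm_le_one : ∀ y, ‖f y‖ ≤ 1
  eq_zero : ∀ y, R < ‖y‖ → f y = 0

lemma BoundedSupport.integrable_mul {f : (d → ℝ) → ℂ} {R : ℝ} (hf : BoundedSupport f R)
    {g : (d → ℝ) → ℂ} (hg : Measurable g) {M : ℝ} (hM : ∀ y, ‖g y‖ ≤ M) :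
    Integrable fun y => f y * g y := by
  have h0 : ∀ y, y ∉ Metric.closedBall (0 : d → ℝ) R → f y * g y = 0 := by
    intro y hy
    rw [mem_closedBall_zero_iff, not_le] at hy
    rw [hf.eq_zero y hy, zero_mul]
  rw [← integrableOn_iff_integrable_of_support_subset (s := Metric.closedBall (0 : d → ℝ) R)
    (Function.support_subset_iff'.2 h0)]
  refine Measure.integrableOn_of_bounded (M := 1 * M) measure_closedBall_lt_top.ne
    (hf.measurable.mul hg).aestronglyMeasurable (Eventually.of_forall fun y => ?_)
  rw [norm_mul]
  exact mul_le_mul (hf.norm_le_one y) (hM y) (norm_nonneg _) zero_le_one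

/-- The periodization of a compactly supported function, as a function on the torus. -/
noncomputable def torusPer (f : (d → ℝ) → ℂ) (R : ℝ) (t : UnitAddTorus d) : ℂ :=
  ∑ k ∈ latticeBall d (R + 1), f (torusRep t + latticeCast k)

lemma torusPer_memLp {f : (d → ℝ) → ℂ} {R : ℝ} (hf : BoundedSupport f R) :
    MemLp (torusPer f R) 2 (volume : Measure (UnitAddTorus d)) := by
  refine MemLp.of_bound (C := (latticeBall d (R + 1)).card) ?_ (Eventually.of_forall fun t => ?_)
  · refine Measurable.aestronglyMeasurable ?_
    unfold torusPer
    exact Finset.measurable_sum _ fun k _ =>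
      hf.measurable.comp (measurable_torusRep.add_const _)
  · refine (norm_sum_le_of_le _ fun k _ => hf.norm_le_one _).trans ?_
    simp

lemma BoundedSupport.ceil_mem {f : (d → ℝ) → ℂ} {R : ℝ} (hf : BoundedSupport f R) {y : d → ℝ}
    (hy : f y ≠ 0) : (fun i => ⌈y i⌉ - 1) ∈ latticeBall d (R + 1) := by
  rw [mem_latticeBall]
  have : ‖y‖ ≤ R := by
    by_contra h
    exact hy (hf.eq_zero y (not_le.1 h))
  linarith [norm_ceil_sub_one_le y]

lemma integral_periodic_mul_torusPer {f : (d → ℝ) → ℂ} {R : ℝ} (hf : BoundedSupport f R)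
    {Φ : UnitAddTorus d → ℂ} {φ : (d → ℝ) → ℂ}
    (hφ : Measurable φ) {M : ℝ} (hM : ∀ y, ‖φ y‖ ≤ M)
    (hΦ : ∀ y ∈ unitCube d, Φ (fun i => (y i : UnitAddCircle)) = φ y)
    (hper : ∀ y k, φ (y + latticeCast k) = φ y) :
    ∫ t, torusPer f R t * Φ t = ∫ y, f y * φ y := by
  rw [UnitAddTorus.integral_preimage _ (fun _ => 0),
    integral_eq_sum_unitCube (hf.integrable_mul hφ hM) (K := latticeBall d (R + 1))
      (fun y hy => hf.ceil_mem (left_ne_zero_of_mul hy)),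
    ← integral_finsetSum]
  · refine setIntegral_congr_fun measurableSet_unitCube fun y hy => ?_
    rw [hΦ y hy, torusPer, torusRep_coe hy, Finset.sum_mul]
    simp_rw [hper]
  · intro k _
    exact ((hf.integrable_mul hφ hM).comp_add_right (latticeCast k)).integrableOn

lemma mFourier_coe (n : d → ℤ) (y : d → ℝ) :
    UnitAddTorus.mFourier n (fun i => (y i : UnitAddCircle))
      = Complex.exp (Complex.I * ((2 * π * ∑ i, n i * y i : ℝ) : ℂ)) := by
  simp only [UnitAddTorus.mFourier, ContinuousMap.coe_mk, fourier_coe_apply]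
  rw [← Complex.exp_sum]
  congr 1
  push_cast
  rw [Finset.mul_sum, Finset.mul_sum]
  refine Finset.sum_congr rfl fun i _ => ?_
  ring

lemma mFourierCoeff_torusPer {f : (d → ℝ) → ℂ} {R : ℝ} (hf : BoundedSupport f R) (n : d → ℤ) :
    UnitAddTorus.mFourierCoeff (torusPer f R) n
      = ∫ y, f y * Complex.exp (Complex.I * ((2 * π * ∑ i, (-n) i * y i : ℝ) : ℂ)) := by
  rw [UnitAddTorus.mFourierCoeff]
  simp_rw [smul_eq_mul, mul_comm (UnitAddTorus.mFourier (-n) _)]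
  refine integral_periodic_mul_torusPer hf (by fun_prop) (M := 1) (fun y => ?_)
    (fun y _ => mFourier_coe (-n) y) fun y k => ?_
  · rw [mul_comm, Complex.norm_exp_ofReal_mul_I]
  · rw [← mFourier_coe, ← mFourier_coe]
    congr 1
    ext i
    simp [latticeCast]

lemma torusPer_coe {g : (d → ℝ) → ℂ} {R : ℝ} (hg : BoundedSupport g R) {y : d → ℝ}
    (hy : ‖y‖ ≤ R) : torusPer g R (fun i => (y i : UnitAddCircle))
      = ∑ j ∈ latticeBall d (2 * R + 2), g (y + latticeCast j) := by
  set c : d → ℤ := fun i => ⌈y i⌉ - 1 with hc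
  have hcn : ‖c‖ ≤ R + 1 := (norm_ceil_sub_one_le y).trans (by linarith)
  have hcube : y - latticeCast c ∈ unitCube d := (sub_latticeCast_mem_unitCube_iff y _).2 rfl
  have hcast : ∀ j, y + latticeCast j = y - latticeCast c + latticeCast (j + c) := by
    intro j; ext i; simp [latticeCast]
  rw [torusPer, torusRep_coe_eq]
  have h1 : ∑ k ∈ latticeBall d (R + 1), g (y - latticeCast c + latticeCast k)
      = ∑ j ∈ (latticeBall d (R + 1)).map (Equiv.subRight c).toEmbedding,
        g (y + latticeCast j) := by
    rw [Finset.sum_map]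
    refine Finset.sum_congr rfl fun k _ => ?_
    rw [hcast]
    simp
  rw [h1]
  refine Finset.sum_subset (fun j hj => ?_) fun j _ hj => ?_
  · obtain ⟨k, hk, rfl⟩ := Finset.mem_map.1 hj
    rw [mem_latticeBall] at hk ⊢
    calc ‖k - c‖ ≤ ‖k‖ + ‖c‖ := norm_sub_le _ _
      _ ≤ _ := by linarith
  · apply hg.eq_zero
    by_contra hle
    refine hj (Finset.mem_map.2 ⟨j + c, ?_, by simp⟩)
    rw [mem_latticeBall, ← norm_latticeCast]
    calc ‖latticeCast (j + c)‖ = ‖y + latticeCast j - (y - latticeCast c)‖ := by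
          rw [hcast]; congr 1; abel
      _ ≤ ‖y + latticeCast j‖ + ‖y - latticeCast c‖ := norm_sub_le _ _
      _ ≤ R + 1 := add_le_add (not_lt.1 hle) (norm_le_one_of_mem_unitCube hcube)

lemma hasSum_periodization {f g : (d → ℝ) → ℂ} {R : ℝ} (hf : BoundedSupport f R)
    (hg : BoundedSupport g R) :
    HasSum (fun n : d → ℤ =>
      (starRingEnd ℂ) (∫ y, f y * Complex.exp (Complex.I * ((2 * π * ∑ i, (-n) i * y i : ℝ) : ℂ))) *
        ∫ y, g y * Complex.exp (Complex.I * ((2 * π * ∑ i, (-n) i * y i : ℝ) : ℂ)))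
      (∑ j ∈ latticeBall d (2 * R + 2), ∫ y, (starRingEnd ℂ) (f y) * g (y + latticeCast j)) := by
  have h := UnitAddTorus.hasSum_prod_mFourierCoeff (torusPer_memLp hf).toLp (torusPer_memLp hg).toLp
  have hc : ∀ {u : (d → ℝ) → ℂ} (hu : BoundedSupport u R) n,
      UnitAddTorus.mFourierCoeff (torusPer_memLp hu).toLp n
        = ∫ y, u y * Complex.exp (Complex.I * ((2 * π * ∑ i, (-n) i * y i : ℝ) : ℂ)) := by
    intro u hu n
    rw [← mFourierCoeff_torusPer hu]
    refine integral_congr_ae ?_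
    filter_upwards [(torusPer_memLp hu).coeFn_toLp] with t ht
    rw [ht]
  simp only [hc hf, hc hg] at h
  convert h using 1
  have hstar : BoundedSupport (fun y => (starRingEnd ℂ) (f y)) R :=
    ⟨Complex.continuous_conj.measurable.comp hf.measurable, fun y => by simpa using hf.norm_le_one y,
      fun y hy => by simp [hf.eq_zero y hy]⟩
  have hconj : ∀ t, (starRingEnd ℂ) (torusPer f R t)
      = torusPer (fun y => (starRingEnd ℂ) (f y)) R t := fun t => by
    simp only [torusPer, map_sum]
  have hmk : Measurable fun y : d → ℝ => (fun i => (y i : UnitAddCircle) : UnitAddTorus d) :=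
    measurable_pi_lambda _ fun i => AddCircle.measurable_mk'.comp (measurable_pi_apply i)
  have hmeas : Measurable fun y : d → ℝ => torusPer g R (fun i => (y i : UnitAddCircle)) := by
    unfold torusPer
    exact Finset.measurable_sum _ fun k _ =>
      hg.measurable.comp ((measurable_torusRep.comp hmk).add_const _)
  calc ∑ j ∈ latticeBall d (2 * R + 2), ∫ y, (starRingEnd ℂ) (f y) * g (y + latticeCast j)
      = ∫ y, (starRingEnd ℂ) (f y) * torusPer g R (fun i => (y i : UnitAddCircle)) := by
        rw [← integral_finsetSum]
        · refine integral_congr_ae (Eventually.of_forall fun y => ?_)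
          beta_reduce
          rw [← Finset.mul_sum]
          rcases le_or_gt ‖y‖ R with hy | hy
          · rw [torusPer_coe hg hy]
          · rw [hf.eq_zero y hy]; simp
        · intro j _
          exact hstar.integrable_mul (hg.measurable.comp (measurable_id.add_const _))
            (fun y => hg.norm_le_one _)
    _ = ∫ t, torusPer (fun y => (starRingEnd ℂ) (f y)) R t * torusPer g R t := by
        refine (integral_periodic_mul_torusPer hstar hmeas
          (M := (latticeBall d (R + 1)).card) (fun y => ?_) (fun _ _ => rfl) fun y k => ?_).symm
        · refine (norm_sum_le_of_le _ fun k _ => hg.norm_le_one _).trans ?_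
          simp
        · congr 1
          ext i
          simp [latticeCast]
    _ = _ := by
        refine integral_congr_ae ?_
        filter_upwards [(torusPer_memLp hf).coeFn_toLp, (torusPer_memLp hg).coeFn_toLp]
          with t h1 h2
        rw [h1, h2, hconj]

end Periodization

/-- A plane wave restricted to a disc. -/
noncomputable def discWave (x : ℝ × ℝ) (ρ : ℝ) (y : Fin 2 → ℝ) : ℂ :=
  Set.indicator (disc ρ) (fun ξ => Complex.exp (Complex.I * (ip2 x ξ : ℂ))) (y 0, y 1)

lemma measurable_discWave_pair (x : ℝ × ℝ) (ρ : ℝ) : Measurable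
    (Set.indicator (disc ρ) (fun ξ => Complex.exp (Complex.I * (ip2 x ξ : ℂ)))) := by
  refine Measurable.indicator ?_ (measurableSet_disc ρ)
  unfold ip2
  fun_prop

lemma boundedSupport_discWave (x : ℝ × ℝ) {ρ R : ℝ} (hR : 0 ≤ R) (h : ρ ≤ R) :
    BoundedSupport (discWave x ρ) R where
  measurable := (measurable_discWave_pair x ρ).comp
    ((measurable_pi_apply 0).prodMk (measurable_pi_apply 1))
  norm_le_one y := by
    unfold discWave
    refine (norm_indicator_le_norm_self _ _).trans ?_
    rw [mul_comm, Complex.norm_exp_ofReal_mul_I]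
  eq_zero y hy := by
    refine Set.indicator_of_notMem (fun hmem => ?_) _
    rw [disc, Set.mem_ofPred_eq] at hmem
    refine absurd hy (not_lt.2 ?_)
    rw [pi_norm_le_iff_of_nonneg hR, Fin.forall_fin_two]
    exact ⟨(abs_fst_le_nrm2 (y 0, y 1)).trans (hmem.le.trans h),
      (abs_snd_le_nrm2 (y 0, y 1)).trans (hmem.le.trans h)⟩

lemma integral_fin_two (F : ℝ × ℝ → ℂ) : ∫ y : Fin 2 → ℝ, F (y 0, y 1) = ∫ ξ, F ξ :=
  (volume_preserving_finTwoArrow ℝ).integral_comp' F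

lemma ip2_add_right (a b c : ℝ × ℝ) : ip2 a (b + c) = ip2 a b + ip2 a c := by simp [ip2]; ring

lemma integral_discWave (x : ℝ × ℝ) {ρ : ℝ} (hρ : 0 < ρ) (m : ℤ × ℤ) :
    ∫ y : Fin 2 → ℝ, discWave x ρ y * Complex.exp (Complex.I *
      ((2 * π * ∑ i, (-(-(finTwoArrowEquiv ℤ).symm m)) i * y i : ℝ) : ℂ))
      = ((ρ ^ 2 * discFT (ρ * rad x m) : ℝ) : ℂ) := by
  rw [rad, ← integral_disc_exp hρ, ← integral_indicator (measurableSet_disc ρ), ← integral_fin_two]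
  refine integral_congr_ae (Eventually.of_forall fun y => ?_)
  simp only [discWave, Set.indicator]
  split_ifs
  · rw [← Complex.exp_add]
    congr 1
    simp [ip2]
    ring
  · simp

lemma integral_discWave_mul (x : ℝ × ℝ) (δ ρ : ℝ) (k : Fin 2 → ℤ) :
    ∫ y : Fin 2 → ℝ, (starRingEnd ℂ) (discWave x δ y) * discWave x ρ (y + latticeCast k)
      = Complex.exp (Complex.I * (ip2 x ((k 0 : ℝ), (k 1 : ℝ)) : ℂ)) *
        (volume.real (disc δ ∩ {ξ | ξ + ((k 0 : ℝ), (k 1 : ℝ)) ∈ disc ρ}) : ℂ) := by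
  set κ : ℝ × ℝ := ((k 0 : ℝ), (k 1 : ℝ)) with hκ
  have hms : MeasurableSet (disc δ ∩ {ξ | ξ + κ ∈ disc ρ}) :=
    (measurableSet_disc δ).inter ((measurable_id.add_const κ) (measurableSet_disc ρ))
  have : (volume.real (disc δ ∩ {ξ | ξ + κ ∈ disc ρ}) : ℂ)
      = ∫ ξ, Set.indicator (disc δ ∩ {ξ | ξ + κ ∈ disc ρ}) (fun _ => (1 : ℂ)) ξ := by
    rw [integral_indicator hms, setIntegral_const]
    simp
  rw [this, ← integral_const_mul, ← integral_fin_two]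
  refine integral_congr_ae (Eventually.of_forall fun y => ?_)
  have hy : discWave x ρ (y + latticeCast k) = Set.indicator (disc ρ)
    (fun ξ => Complex.exp (Complex.I * (ip2 x ξ : ℂ))) ((y 0, y 1) + κ) := rfl
  beta_reduce
  rw [hy, discWave]
  by_cases h1 : (y 0, y 1) ∈ disc δ
  swap
  · simp [Set.indicator, h1]
  by_cases h2 : (y 0, y 1) + κ ∈ disc ρ
  swap
  · simp [Set.indicator, h2]
  have h3 : (y 0, y 1) ∈ disc δ ∩ {ξ | ξ + κ ∈ disc ρ} := ⟨h1, h2⟩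
  rw [Set.indicator_of_mem h1, Set.indicator_of_mem h2, Set.indicator_of_mem h3, mul_one]
  rw [← Complex.exp_conj, ← Complex.exp_add]
  congr 1
  rw [ip2_add_right]
  simp
  ring

/-- The integer points of sup norm at most `R`. -/
noncomputable def intBox (R : ℝ) : Finset (ℤ × ℤ) :=
  (isCompact_closedBall (0 : ℤ × ℤ) R).finite_of_discrete.toFinset

lemma mem_intBox {R : ℝ} {k : ℤ × ℤ} : k ∈ intBox R ↔ ‖k‖ ≤ R := by
  simp [intBox]

/-- The lattice point `k` as a point of the plane. -/
def intPt (k : ℤ × ℤ) : ℝ × ℝ := ((k.1 : ℝ), (k.2 : ℝ))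

lemma hasSum_discFT_mul (x : ℝ × ℝ) {δ ρ : ℝ} (hδ : 0 < δ) (hρ : δ ≤ ρ) :
    HasSum (fun m : ℤ × ℤ =>
      (((δ ^ 2 * discFT (δ * rad x m)) * (ρ ^ 2 * discFT (ρ * rad x m)) : ℝ) : ℂ))
      (∑ k ∈ intBox (2 * ρ + 2), Complex.exp (Complex.I * (ip2 x (intPt k) : ℂ)) *
        (volume.real (disc δ ∩ {ξ | ξ + intPt k ∈ disc ρ}) : ℂ)) := by
  have hρ0 : 0 < ρ := hδ.trans_le hρ
  have h := hasSum_periodization (boundedSupport_discWave x hρ0.le hρ)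
    (boundedSupport_discWave x hρ0.le le_rfl)
  rw [← (((finTwoArrowEquiv ℤ).symm.trans (Equiv.neg (Fin 2 → ℤ))).hasSum_iff)] at h
  convert h using 1
  · ext m
    simp only [Function.comp, Equiv.trans_apply, Equiv.neg_apply]
    rw [integral_discWave x hδ, integral_discWave x hρ0, Complex.conj_ofReal]
    push_cast; rfl
  · symm
    refine Finset.sum_equiv (finTwoArrowEquiv ℤ) (fun k => ?_) fun k _ => ?_
    · rw [mem_intBox, mem_latticeBall, Prod.norm_def, pi_norm_le_iff_of_nonneg (by positivity),
        Fin.forall_fin_two, max_le_iff]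
      rfl
    · rw [integral_discWave_mul]
      rfl

lemma integral_cos_mul_gaussian (d : ℝ) {T : ℝ} (hT : 0 < T) :
    ∫ l : ℝ, Real.cos (l * d) * Real.exp (-(l / T) ^ 2)
      = T * √π * Real.exp (-(T ^ 2 * d ^ 2 / 4)) := by
  have hb : 0 < ((T⁻¹ ^ 2 : ℝ) : ℂ).re := by rw [Complex.ofReal_re]; positivity
  have h := fourierIntegral_gaussian hb (d : ℂ)
  have hre := congrArg Complex.re h
  have hint : Integrable fun l : ℝ =>
      Complex.exp (Complex.I * d * l) * Complex.exp (-((T⁻¹ ^ 2 : ℝ) : ℂ) * l ^ 2) := by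
    refine (integrable_cexp_neg_mul_sq hb).bdd_mul (c := 1)
      (by fun_prop) (Eventually.of_forall fun l => ?_)
    rw [show Complex.I * d * l = ((d * l : ℝ) : ℂ) * Complex.I by push_cast; ring,
      Complex.norm_exp_ofReal_mul_I]
  rw [← RCLike.re_eq_complex_re, ← integral_re hint, RCLike.re_eq_complex_re] at hre
  have h1 : ∀ l : ℝ, (Complex.exp (Complex.I * d * l) *
      Complex.exp (-((T⁻¹ ^ 2 : ℝ) : ℂ) * l ^ 2)).re
      = Real.cos (l * d) * Real.exp (-(l / T) ^ 2) := by
    intro l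
    rw [show -((T⁻¹ ^ 2 : ℝ) : ℂ) * (l : ℂ) ^ 2 = ((-(l / T) ^ 2 : ℝ) : ℂ) by
      push_cast; rw [div_eq_mul_inv]; ring, ← Complex.ofReal_exp, Complex.re_mul_ofReal,
      show Complex.I * d * l = ((l * d : ℝ) : ℂ) * Complex.I by push_cast; ring,
      Complex.exp_ofReal_mul_I_re]
  simp only [h1] at hre
  rw [hre]
  have h2 : -(d : ℂ) ^ 2 / (4 * ((T⁻¹ ^ 2 : ℝ) : ℂ)) = ((-(T ^ 2 * d ^ 2 / 4) : ℝ) : ℂ) := by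
    have : (T : ℂ) ≠ 0 := by exact_mod_cast hT.ne'
    push_cast
    field_simp
  have h3 : ((π : ℂ) / ((T⁻¹ ^ 2 : ℝ) : ℂ)) ^ (1 / 2 : ℂ) = ((T * √π : ℝ) : ℂ) := by
    rw [← Complex.ofReal_div, show (1 / 2 : ℂ) = ((1 / 2 : ℝ) : ℂ) by push_cast; rfl,
      ← Complex.ofReal_cpow (by positivity), ← Real.sqrt_eq_rpow]
    congr 1
    rw [show π / T⁻¹ ^ 2 = T ^ 2 * π by field_simp, Real.sqrt_mul (by positivity),
      Real.sqrt_sq hT.le]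
  rw [h2, h3, ← Complex.ofReal_exp, ← Complex.ofReal_mul, Complex.ofReal_re]

lemma integrable_cos_mul_gaussian (d : ℝ) {T : ℝ} (hT : 0 < T) :
    Integrable fun l : ℝ => Real.cos (l * d) * Real.exp (-(l / T) ^ 2) := by
  have h := integrable_exp_neg_mul_sq (b := T⁻¹ ^ 2) (by positivity)
  have h2 : Integrable fun l : ℝ => Real.exp (-(l / T) ^ 2) := by
    refine h.congr (Eventually.of_forall fun l => ?_)
    beta_reduce
    congr 1
    rw [div_eq_mul_inv]; ring
  exact h2.bdd_mul (c := 1) (by fun_prop) (Eventually.of_forall fun l => Real.abs_cos_le_one _)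

/-- Mean square of a finite trigonometric sum, with a Gaussian cutoff. -/
lemma integral_sq_finset_sum_sin_le {ι : Type*} (s : Finset ι) (b r : ι → ℝ) (θ : ℝ) {T : ℝ}
    (hT : 1 ≤ T) :
    ∫ l in (1 : ℝ)..T, (∑ i ∈ s, b i * Real.sin (l * r i - θ)) ^ 2
      ≤ Real.exp 1 * (T * √π * ∑ i ∈ s, ∑ j ∈ s,
        |b i| * |b j| * Real.exp (-(T ^ 2 * (r i - r j) ^ 2 / 4))) := by
  have hT0 : 0 < T := by linarith
  have hkey : ∀ l : ℝ, ∑ i ∈ s, ∑ j ∈ s, b i * b j * Real.cos (l * (r i - r j))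
      = (∑ i ∈ s, b i * Real.sin (l * r i - θ)) ^ 2
        + (∑ i ∈ s, b i * Real.cos (l * r i - θ)) ^ 2 := by
    intro l
    rw [sq, sq, Finset.sum_mul_sum, Finset.sum_mul_sum, ← Finset.sum_add_distrib]
    refine Finset.sum_congr rfl fun i _ => ?_
    rw [← Finset.sum_add_distrib]
    refine Finset.sum_congr rfl fun j _ => ?_
    rw [show l * (r i - r j) = (l * r i - θ) - (l * r j - θ) by ring, Real.cos_sub]
    ring
  set G : ℝ → ℝ := fun l => Real.exp 1 * ∑ i ∈ s, ∑ j ∈ s,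
    b i * b j * (Real.cos (l * (r i - r j)) * Real.exp (-(l / T) ^ 2)) with hG
  have hGeq : ∀ l, G l = Real.exp 1 * Real.exp (-(l / T) ^ 2) *
      ∑ i ∈ s, ∑ j ∈ s, b i * b j * Real.cos (l * (r i - r j)) := by
    intro l
    rw [hG]
    simp only [Finset.mul_sum]
    refine Finset.sum_congr rfl fun i _ => Finset.sum_congr rfl fun j _ => ?_
    ring
  have hGint : Integrable G := by
    refine Integrable.const_mul ?_ _
    refine integrable_finsetSum _ fun i _ => integrable_finsetSum _ fun j _ => ?_
    exact (integrable_cos_mul_gaussian _ hT0).const_mul _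
  have hG0 : ∀ l, 0 ≤ G l := by
    intro l
    rw [hGeq, hkey]
    positivity
  calc ∫ l in (1 : ℝ)..T, (∑ i ∈ s, b i * Real.sin (l * r i - θ)) ^ 2
      ≤ ∫ l in (1 : ℝ)..T, G l := by
        refine intervalIntegral.integral_mono_on hT
          (Continuous.intervalIntegrable (by fun_prop) _ _) hGint.intervalIntegrable ?_
        intro l hl
        rw [hGeq, hkey, ← Real.exp_add]
        have h1 : 1 ≤ Real.exp (1 + -(l / T) ^ 2) := by
          rw [Real.one_le_exp_iff]
          have : l / T ≤ 1 := (div_le_one hT0).2 hl.2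
          have h0 : 0 ≤ l / T := div_nonneg (by linarith [hl.1]) hT0.le
          nlinarith
        nlinarith [sq_nonneg (∑ i ∈ s, b i * Real.sin (l * r i - θ)),
          sq_nonneg (∑ i ∈ s, b i * Real.cos (l * r i - θ))]
    _ ≤ ∫ l, G l := by
        rw [intervalIntegral.integral_of_le hT]
        exact setIntegral_le_integral hGint (Eventually.of_forall hG0)
    _ = Real.exp 1 * ∑ i ∈ s, ∑ j ∈ s, b i * b j *
          (T * √π * Real.exp (-(T ^ 2 * (r i - r j) ^ 2 / 4))) := by
        rw [hG, integral_const_mul, integral_finsetSum _ fun i _ => integrable_finsetSum _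
          fun j _ => (integrable_cos_mul_gaussian _ hT0).const_mul _]
        congr 1
        refine Finset.sum_congr rfl fun i _ => ?_
        rw [integral_finsetSum _ fun j _ => (integrable_cos_mul_gaussian _ hT0).const_mul _]
        refine Finset.sum_congr rfl fun j _ => ?_
        rw [integral_const_mul, integral_cos_mul_gaussian _ hT0]
    _ ≤ _ := by
        refine mul_le_mul_of_nonneg_left ?_ (Real.exp_pos 1).le
        simp only [Finset.mul_sum]
        refine Finset.sum_le_sum fun i _ => Finset.sum_le_sum fun j _ => ?_
        have h1 : b i * b j ≤ |b i| * |b j| := by rw [← abs_mul]; exact le_abs_self _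
        have h2 : 0 ≤ T * √π * Real.exp (-(T ^ 2 * (r i - r j) ^ 2 / 4)) := by positivity
        calc _ ≤ |b i| * |b j| * (T * √π * Real.exp (-(T ^ 2 * (r i - r j) ^ 2 / 4))) :=
              mul_le_mul_of_nonneg_right h1 h2
          _ = _ := by ring

lemma continuous_tsum_sin {ι : Type*} {b r : ι → ℝ} (hb : Summable b) (θ : ℝ) :
    Continuous fun l : ℝ => ∑' i, b i * Real.sin (l * r i - θ) := by
  refine continuous_tsum (fun i => by fun_prop) hb.abs fun i l => ?_
  rw [Real.norm_eq_abs, abs_mul]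
  exact mul_le_of_le_one_right (abs_nonneg _) (Real.abs_sin_le_one _)

/-- Mean square of an absolutely convergent trigonometric series. -/
lemma integral_sq_tsum_sin_le {ι : Type*} [Countable ι] {b r : ι → ℝ} (hb : Summable b) (θ : ℝ)
    {T K : ℝ} (hT : 1 ≤ T) (hK : ∀ s : Finset ι, ∑ i ∈ s, ∑ j ∈ s,
        |b i| * |b j| * Real.exp (-(T ^ 2 * (r i - r j) ^ 2 / 4)) ≤ K) :
    ∫ l in (1 : ℝ)..T, (∑' i, b i * Real.sin (l * r i - θ)) ^ 2
      ≤ Real.exp 1 * (T * √π * K) := by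
  have hsum : ∀ l : ℝ, Summable fun i => b i * Real.sin (l * r i - θ) := fun l =>
    hb.abs.of_norm_bounded fun i => by
      rw [Real.norm_eq_abs, abs_mul]
      exact mul_le_of_le_one_right (abs_nonneg _) (Real.abs_sin_le_one _)
  have hlim : Tendsto (fun s : Finset ι =>
      ∫ l in (1 : ℝ)..T, (∑ i ∈ s, b i * Real.sin (l * r i - θ)) ^ 2) atTop
      (nhds (∫ l in (1 : ℝ)..T, (∑' i, b i * Real.sin (l * r i - θ)) ^ 2)) := by
    refine intervalIntegral.tendsto_integral_filter_of_dominated_convergence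
      (fun _ => (∑' i, |b i|) ^ 2) (Eventually.of_forall fun s => ?_)
      (Eventually.of_forall fun s => Eventually.of_forall fun l _ => ?_)
      intervalIntegrable_const (Eventually.of_forall fun l _ => ?_)
    · exact Continuous.aestronglyMeasurable (by fun_prop)
    · rw [Real.norm_eq_abs, abs_pow]
      refine pow_le_pow_left₀ (abs_nonneg _) ?_ 2
      refine (Finset.abs_sum_le_sum_abs _ _).trans
        ((Finset.sum_le_sum fun i _ => ?_).trans (hb.abs.sum_le_tsum s fun i _ => abs_nonneg _))
      rw [abs_mul]
      exact mul_le_of_le_one_right (abs_nonneg _) (Real.abs_sin_le_one _)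
    · exact (hsum l).hasSum.pow 2
  refine le_of_tendsto hlim (Eventually.of_forall fun s => ?_)
  refine (integral_sq_finset_sum_sin_le s b r θ hT).trans ?_
  have hT0 : 0 ≤ T := by linarith
  gcongr
  exact hK s

/-- The decay of the smoothed coefficients. -/
noncomputable def radWeight (x : ℝ × ℝ) (T : ℝ) (m : ℤ × ℤ) : ℝ :=
  rad x m ^ (-(3 / 2) : ℝ) * min 1 (T / rad x m) ^ (3 / 2 : ℝ)

lemma radWeight_nonneg (x : ℝ × ℝ) {T : ℝ} (hT : 0 ≤ T) (m : ℤ × ℤ) : 0 ≤ radWeight x T m := by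
  have := rad_nonneg x m
  unfold radWeight
  have : 0 ≤ T / rad x m := by positivity
  have : 0 ≤ min 1 (T / rad x m) := le_min zero_le_one this
  positivity

lemma rad_pos {x : ℝ × ℝ} (hx : ¬ ∃ m : ℤ × ℤ, x = (2 * Real.pi * m.1, 2 * Real.pi * m.2))
    (m : ℤ × ℤ) : 0 < rad x m := by
  obtain ⟨c, hc, h⟩ := exists_rad_lower hx
  exact lt_of_lt_of_le (by positivity) (h m)

lemma radWeight_mul_le {x : ℝ × ℝ}
    (hx : ¬ ∃ m : ℤ × ℤ, x = (2 * Real.pi * m.1, 2 * Real.pi * m.2)) {T : ℝ} (hT : 0 < T)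
    (i j : ℤ × ℤ) :
    radWeight x T i * radWeight x T j * Real.exp (-(T ^ 2 * (rad x i - rad x j) ^ 2 / 4))
      ≤ 16 * (pairKernel x (i, j) + pairKernel x (j, i)) := by
  have h1 := pairKernel_nonneg x (i, j)
  have h2 := pairKernel_nonneg x (j, i)
  rcases le_total (rad x i) (rad x j) with h | h
  · have := pair_weight_le (rad_pos hx i) h hT
    have h3 : pairKernel x (i, j) = _ := if_pos h
    simp only at h3
    rw [← h3] at this
    unfold radWeight
    linarith
  · have := pair_weight_le (rad_pos hx j) h hT
    have h3 : pairKernel x (j, i) = _ := if_pos h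
    simp only at h3
    rw [← h3] at this
    unfold radWeight
    rw [show (rad x i - rad x j) ^ 2 = (rad x j - rad x i) ^ 2 by ring]
    linarith

lemma finite_nrm2_le (Q : ℝ) :
    {m : ℤ × ℤ | nrm2 (2 * Real.pi * m.1, 2 * Real.pi * m.2) ≤ Q}.Finite := by
  refine (isCompact_closedBall (0 : ℤ × ℤ) |Q|).finite_of_discrete.subset fun m hm => ?_
  rw [Set.mem_ofPred_eq] at hm
  rw [mem_closedBall_zero_iff, Prod.norm_def, max_le_iff, Int.norm_eq_abs, Int.norm_eq_abs]
  have hπ := Real.pi_gt_three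
  have key : ∀ t : ℤ, |2 * Real.pi * t| ≤ nrm2 (2 * Real.pi * m.1, 2 * Real.pi * m.2) →
      |(t : ℝ)| ≤ |Q| := by
    intro t ht
    rw [abs_mul, abs_of_pos (by positivity)] at ht
    have := le_abs_self Q
    nlinarith [abs_nonneg (t : ℝ)]
  exact ⟨key _ (Real.abs_le_sqrt (by nlinarith [sq_nonneg (2 * Real.pi * (m.2 : ℝ))])),
    key _ (Real.abs_le_sqrt (by nlinarith [sq_nonneg (2 * Real.pi * (m.1 : ℝ))]))⟩

/-- The off-diagonal sum of the smoothed coefficients has small tails, uniformly in `T`. -/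
lemma exists_radWeight_tail {x : ℝ × ℝ}
    (hx : ¬ ∃ m : ℤ × ℤ, x = (2 * Real.pi * m.1, 2 * Real.pi * m.2)) {ε : ℝ} (hε : 0 < ε) :
    ∃ Q₀ : ℝ, ∀ Q ≥ Q₀, ∀ T > 0, ∀ s : Finset (ℤ × ℤ),
      (∀ m ∈ s, Q < nrm2 (2 * Real.pi * m.1, 2 * Real.pi * m.2)) →
      ∑ i ∈ s, ∑ j ∈ s, radWeight x T i * radWeight x T j *
        Real.exp (-(T ^ 2 * (rad x i - rad x j) ^ 2 / 4)) ≤ ε := by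
  obtain ⟨S, hS⟩ := summable_iff_vanishing_norm.1 (summable_pairKernel hx) (ε / 32) (by positivity)
  obtain ⟨Q₀, hQ₀⟩ := (S.image fun q =>
    nrm2 (2 * Real.pi * (q.1.1 : ℝ), 2 * Real.pi * (q.1.2 : ℝ))).bddAbove
  refine ⟨Q₀, fun Q hQ T hT s hs => ?_⟩
  have hdis : Disjoint (s ×ˢ s) S := by
    rw [Finset.disjoint_left]
    intro q hq hqS
    have h1 := hs q.1 (Finset.mem_product.1 hq).1
    have h2 := hQ₀ (Finset.mem_coe.2 (Finset.mem_image_of_mem _ hqS))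
    beta_reduce at h2
    linarith
  have h := hS _ hdis
  rw [Real.norm_eq_abs, Finset.sum_product] at h
  have h' := (le_abs_self _).trans h.le
  calc _ ≤ ∑ i ∈ s, ∑ j ∈ s, 16 * (pairKernel x (i, j) + pairKernel x (j, i)) :=
        Finset.sum_le_sum fun i _ => Finset.sum_le_sum fun j _ => radWeight_mul_le hx hT i j
    _ = 16 * (∑ i ∈ s, ∑ j ∈ s, pairKernel x (i, j) + ∑ i ∈ s, ∑ j ∈ s, pairKernel x (i, j)) := by
        simp only [← Finset.mul_sum, Finset.sum_add_distrib]
        rw [Finset.sum_comm (f := fun i j => pairKernel x (j, i))]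
    _ ≤ ε := by linarith

/-- The number of lattice points whose norm is within `1 / T` of `l`. -/
noncomputable def edgeCount (T l : ℝ) : ℝ :=
  ∑ k ∈ intBox (T + 1),
    Set.indicator (Set.Ioo (nrm2 (intPt k) - 1 / T) (nrm2 (intPt k) + 1 / T)) (fun _ => (1 : ℝ)) l

lemma edgeCount_nonneg (T l : ℝ) : 0 ≤ edgeCount T l :=
  Finset.sum_nonneg fun _ _ => Set.indicator_nonneg (fun _ _ => zero_le_one) _

lemma nrm2_intPt_nonneg (k : ℤ × ℤ) : 0 ≤ nrm2 (intPt k) := Real.sqrt_nonneg _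

lemma nrm2_intPt_sq (k : ℤ × ℤ) : nrm2 (intPt k) ^ 2 = (k.1 : ℝ) ^ 2 + (k.2 : ℝ) ^ 2 :=
  Real.sq_sqrt (by positivity)

lemma norm_le_nrm2_intPt (k : ℤ × ℤ) : ‖k‖ ≤ nrm2 (intPt k) := by
  rw [Prod.norm_def, max_le_iff, Int.norm_eq_abs, Int.norm_eq_abs]
  exact ⟨abs_fst_le_nrm2 (intPt k), abs_snd_le_nrm2 (intPt k)⟩

lemma edgeCount_le {T l : ℝ} (hl : 1 ≤ l) (hlT : l ≤ T) :
    edgeCount T l ≤ 40000 * l ^ (2 / 3 : ℝ) := by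
  classical
  have hT : 0 < T := by linarith
  have hδ0 : 0 < 1 / T := by positivity
  have hδl : 1 / T * l ≤ 1 := by
    rw [one_div, inv_mul_le_one₀ hT]; exact hlT
  have hδ1 : 1 / T ≤ 1 := by nlinarith
  set V := max 0 (l ^ 2 - 2) with hV
  have hV0 : 0 ≤ V := le_max_left _ _
  have hVl : V ≤ l ^ 2 := max_le (by positivity) (by linarith)
  have hVl2 : l ^ 2 - 2 ≤ V := le_max_right _ _
  set S := (intBox (T + 1)).filter
    (fun k => l ∈ Set.Ioo (nrm2 (intPt k) - 1 / T) (nrm2 (intPt k) + 1 / T)) with hS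
  have hcard : edgeCount T l = S.card := by
    rw [edgeCount, hS, Finset.card_filter]
    push_cast
    exact Finset.sum_congr rfl fun k _ => by simp only [Set.indicator]
  have hmem : ∀ k ∈ S, V ≤ (k.1 : ℝ) ^ 2 + (k.2 : ℝ) ^ 2 ∧
      (k.1 : ℝ) ^ 2 + (k.2 : ℝ) ^ 2 < V + 5 := by
    intro k hk
    obtain ⟨h1, h2⟩ := (Finset.mem_filter.1 hk).2
    have h0 := nrm2_intPt_nonneg k
    rw [← nrm2_intPt_sq]
    constructor
    · refine max_le (by positivity) ?_
      nlinarith [mul_self_nonneg (l - 1 / T)]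
    · nlinarith
  set A : ℕ → Finset (ℤ × ℤ) := fun i => S.filter fun k =>
    V + i ≤ (k.1 : ℝ) ^ 2 + (k.2 : ℝ) ^ 2 ∧ (k.1 : ℝ) ^ 2 + (k.2 : ℝ) ^ 2 < V + i + 1 with hA
  have hcover : S ⊆ (Finset.range 5).biUnion A := by
    intro k hk
    obtain ⟨h1, h2⟩ := hmem k hk
    have h3 : 0 ≤ (k.1 : ℝ) ^ 2 + (k.2 : ℝ) ^ 2 - V := by linarith
    refine Finset.mem_biUnion.2 ⟨⌊(k.1 : ℝ) ^ 2 + (k.2 : ℝ) ^ 2 - V⌋₊, ?_, ?_⟩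
    · rw [Finset.mem_range, Nat.floor_lt h3]
      push_cast
      linarith
    · refine Finset.mem_filter.2 ⟨hk, ?_, ?_⟩
      · linarith [Nat.floor_le h3]
      · linarith [Nat.lt_floor_add_one ((k.1 : ℝ) ^ 2 + (k.2 : ℝ) ^ 2 - V)]
  have hAi : ∀ i ∈ Finset.range 5, ((A i).card : ℝ) ≤ 8000 * l ^ (2 / 3 : ℝ) := by
    intro i hi
    have hi5 : (i : ℝ) ≤ 4 := by
      have := Finset.mem_range.1 hi
      exact_mod_cast Nat.le_of_lt_succ this
    have hVi : 0 ≤ V + i := by positivity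
    refine (shell_card_le (0 : ℝ × ℝ) hVi (S := A i) (fun k hk => by
      simpa using (Finset.mem_filter.1 hk).2)).trans ?_
    have h1 : (1 + (V + i)) ^ (1 / 3 : ℝ) ≤ (8 * l ^ 2) ^ (1 / 3 : ℝ) :=
      Real.rpow_le_rpow (by linarith) (by nlinarith) (by norm_num)
    have h2 : (8 * l ^ 2 : ℝ) ^ (1 / 3 : ℝ) = 2 * l ^ (2 / 3 : ℝ) := by
      rw [Real.mul_rpow (by norm_num) (by positivity), ← Real.rpow_natCast l 2,
        ← Real.rpow_mul (by linarith), show (8 : ℝ) = 2 ^ (3 : ℝ) by norm_num,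
        ← Real.rpow_mul (by norm_num)]
      norm_num
    linarith
  rw [hcard]
  calc (S.card : ℝ) ≤ (((Finset.range 5).biUnion A).card : ℝ) := by
        exact_mod_cast Finset.card_le_card hcover
    _ ≤ ∑ i ∈ Finset.range 5, ((A i).card : ℝ) := by exact_mod_cast Finset.card_biUnion_le
    _ ≤ ∑ i ∈ Finset.range 5, 8000 * l ^ (2 / 3 : ℝ) := Finset.sum_le_sum hAi
    _ = 40000 * l ^ (2 / 3 : ℝ) := by rw [Finset.sum_const, Finset.card_range]; ring

lemma integrable_edge_indicator (a b : ℝ) :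
    Integrable (Set.indicator (Set.Ioo a b) fun _ => (1 : ℝ)) := by
  rw [integrable_indicator_iff measurableSet_Ioo]
  exact integrableOn_const (by simp)

lemma integrable_edgeCount (T : ℝ) : Integrable (edgeCount T) :=
  integrable_finsetSum _ fun _ _ => integrable_edge_indicator _ _

lemma integral_edgeCount_le {T : ℝ} (hT : 1 ≤ T) :
    ∫ l in (1 : ℝ)..T, edgeCount T l ≤ 50 * T := by
  have hT0 : 0 < T := by linarith
  have hcard : ((intBox (T + 1)).card : ℝ) ≤ (5 * T) ^ 2 := by
    refine (card_le_of_mem_box (a := 0) (B := T + 1) (by linarith) fun k hk => ?_).trans ?_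
    · rw [mem_intBox, Prod.norm_def, max_le_iff, Int.norm_eq_abs, Int.norm_eq_abs] at hk
      simpa using hk
    · gcongr
      linarith
  calc ∫ l in (1 : ℝ)..T, edgeCount T l ≤ ∫ l, edgeCount T l := by
        rw [intervalIntegral.integral_of_le hT]
        exact setIntegral_le_integral (integrable_edgeCount T)
          (Eventually.of_forall (edgeCount_nonneg T))
    _ = ∑ k ∈ intBox (T + 1), 2 / T := by
        unfold edgeCount
        rw [integral_finsetSum _ fun _ _ => integrable_edge_indicator _ _]
        refine Finset.sum_congr rfl fun k _ => ?_
        rw [integral_indicator measurableSet_Ioo, setIntegral_const, Real.volume_real_Ioo_of_le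
          (by linarith [show 0 < 1 / T by positivity])]
        rw [smul_eq_mul]; ring
    _ ≤ (5 * T) ^ 2 * (2 / T) := by
        rw [Finset.sum_const, nsmul_eq_mul]
        gcongr
    _ = 50 * T := by field_simp; norm_num

/-- The edge count is negligible in mean square at the scale `√l`. -/
lemma exists_edgeCount_sq_le {ε : ℝ} (hε : 0 < ε) : ∃ K : ℝ, 0 ≤ K ∧ ∀ T l : ℝ, 1 ≤ l → l ≤ T →
    (1 + edgeCount T l) ^ 2 / l ≤ ε * (1 + edgeCount T l) + K / l ^ 2 := by
  refine ⟨40001 ^ 2 * (40001 / ε) ^ 9, by positivity, fun T l hl hlT => ?_⟩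
  have hl0 : 0 < l := by linarith
  have hE := edgeCount_nonneg T l
  set y := l ^ (1 / 3 : ℝ) with hy
  have hy1 : 1 ≤ y := Real.one_le_rpow hl (by norm_num)
  have hyl : y ^ 3 = l := by
    rw [hy, ← Real.rpow_natCast, ← Real.rpow_mul hl0.le]; norm_num
  have hy2 : l ^ (2 / 3 : ℝ) = y ^ 2 := by
    rw [hy, ← Real.rpow_natCast, ← Real.rpow_mul hl0.le]; norm_num
  have hE2 : 1 + edgeCount T l ≤ 40001 * y ^ 2 := by
    have := edgeCount_le hl hlT
    rw [hy2] at this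
    nlinarith
  set F := 1 + edgeCount T l with hF
  have hF0 : 0 ≤ F := by linarith
  rw [← hyl]
  have hy0 : 0 < y := by linarith
  by_cases hc : 40001 / ε ≤ y
  · have h1 : F ^ 2 / y ^ 3 ≤ ε * F := by
      rw [div_le_iff₀ (by positivity)]
      rw [div_le_iff₀ hε] at hc
      have : F ≤ ε * y ^ 3 := hE2.trans (by nlinarith [sq_nonneg y])
      nlinarith
    have : 0 ≤ 40001 ^ 2 * (40001 / ε) ^ 9 / (y ^ 3) ^ 2 := by positivity
    linarith
  · push Not at hc
    have h1 : F ^ 2 / y ^ 3 ≤ 40001 ^ 2 * (40001 / ε) ^ 9 / (y ^ 3) ^ 2 := by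
      rw [div_le_div_iff₀ (by positivity) (by positivity)]
      have h2 : F ^ 2 ≤ (40001 * y ^ 2) ^ 2 := by gcongr
      have h3 : y ^ 9 ≤ (40001 / ε) ^ 9 := by gcongr
      have h4 : y ^ 7 ≤ y ^ 9 := pow_le_pow_right₀ hy1 (by norm_num)
      calc F ^ 2 * (y ^ 3) ^ 2 ≤ (40001 * y ^ 2) ^ 2 * (y ^ 3) ^ 2 := by gcongr
        _ = 40001 ^ 2 * y ^ 7 * y ^ 3 := by ring
        _ ≤ 40001 ^ 2 * (40001 / ε) ^ 9 * y ^ 3 := by gcongr; exact h4.trans h3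
    have : 0 ≤ ε * F := by positivity
    linarith

lemma norm_exp_I_mul (t : ℝ) : ‖Complex.exp (Complex.I * (t : ℂ))‖ = 1 := by
  rw [mul_comm, Complex.norm_exp_ofReal_mul_I]

/-- Comparison of the sharp and the smoothed lattice sums. -/
lemma norm_smoothed_sub_sharp_le (x : ℝ × ℝ) {T l : ℝ} (hl : 1 ≤ l) (hlT : l ≤ T) :
    ‖∑ k ∈ intBox (2 * l + 2), Complex.exp (Complex.I * (ip2 x (intPt k) : ℂ)) *
        ((volume.real (disc (1 / T) ∩ {ξ | ξ + intPt k ∈ disc l}) / (π * (1 / T) ^ 2) : ℝ) : ℂ)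
      - ∑' k : ℤ × ℤ, (if 0 < nrm2 (intPt k) ∧ nrm2 (intPt k) < l then
          Complex.exp (Complex.I * (ip2 x (intPt k) : ℂ)) else 0)‖ ≤ 1 + edgeCount T l := by
  classical
  have hT : 0 < T := by linarith
  have hδ : 0 < 1 / T := by positivity
  have hδ1 : 1 / T ≤ 1 := by rw [div_le_one hT]; linarith
  set φ : ℤ × ℤ → ℝ := fun k =>
    volume.real (disc (1 / T) ∩ {ξ | ξ + intPt k ∈ disc l}) / (π * (1 / T) ^ 2) with hφ
  have hvol := volume_real_disc hδ
  have hv0 : 0 < π * (1 / T) ^ 2 := by have := Real.pi_pos; positivity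
  have hφ0 : ∀ k, 0 ≤ φ k := fun k => div_nonneg measureReal_nonneg hv0.le
  have hφ1 : ∀ k, φ k ≤ 1 := by
    intro k
    rw [hφ, div_le_one hv0, ← hvol]
    exact measureReal_mono Set.inter_subset_left (volume_disc_lt_top _).ne
  have hin : ∀ k, nrm2 (intPt k) + 1 / T ≤ l → φ k = 1 := by
    intro k hk
    have : disc (1 / T) ∩ {ξ | ξ + intPt k ∈ disc l} = disc (1 / T) := by
      refine Set.inter_eq_left.2 fun ξ hξ => ?_
      rw [disc, Set.mem_ofPred_eq] at hξ
      rw [Set.mem_ofPred_eq, disc, Set.mem_ofPred_eq]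
      linarith [nrm2_add_le ξ (intPt k)]
    rw [hφ]
    beta_reduce
    rw [this, hvol, div_self hv0.ne']
  have hout : ∀ k, l ≤ nrm2 (intPt k) - 1 / T → φ k = 0 := by
    intro k hk
    have : disc (1 / T) ∩ {ξ | ξ + intPt k ∈ disc l} = ∅ := by
      refine Set.eq_empty_of_forall_notMem fun ξ hξ => ?_
      obtain ⟨h1, h2⟩ := hξ
      rw [disc, Set.mem_ofPred_eq] at h1
      rw [Set.mem_ofPred_eq, disc, Set.mem_ofPred_eq] at h2
      have := nrm2_add_le (ξ + intPt k) (-ξ)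
      rw [nrm2_neg, add_neg_cancel_comm] at this
      linarith
    rw [hφ]
    beta_reduce
    rw [this, measureReal_empty, zero_div]
  rw [tsum_eq_sum (s := intBox (2 * l + 2)) (fun k hk => if_neg fun h => hk (mem_intBox.2
    ((norm_le_nrm2_intPt k).trans (by linarith [h.2])))), ← Finset.sum_sub_distrib]
  set e : ℤ × ℤ → ℝ := fun k => Set.indicator
    (Set.Ioo (nrm2 (intPt k) - 1 / T) (nrm2 (intPt k) + 1 / T)) (fun _ => (1 : ℝ)) l with he
  have he0 : ∀ k, 0 ≤ e k := fun k => Set.indicator_nonneg (fun _ _ => zero_le_one) _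
  have hterm : ∀ k, ‖Complex.exp (Complex.I * (ip2 x (intPt k) : ℂ)) * ((φ k : ℝ) : ℂ)
      - (if 0 < nrm2 (intPt k) ∧ nrm2 (intPt k) < l then
          Complex.exp (Complex.I * (ip2 x (intPt k) : ℂ)) else 0)‖
      ≤ (if k = 0 then 1 else 0) + e k := by
    intro k
    have h01 : (0 : ℝ) ≤ if k = 0 then 1 else 0 := by split_ifs <;> norm_num
    by_cases hk : 0 < nrm2 (intPt k)
    · by_cases hkl : nrm2 (intPt k) < l
      · rw [if_pos ⟨hk, hkl⟩, ← mul_sub_one, norm_mul, norm_exp_I_mul, one_mul]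
        rw [← Complex.ofReal_one, ← Complex.ofReal_sub, Complex.norm_real, Real.norm_eq_abs]
        by_cases h : nrm2 (intPt k) + 1 / T ≤ l
        · rw [hin k h, sub_self, abs_zero]; linarith [he0 k]
        · push Not at h
          have hmem : l ∈ Set.Ioo (nrm2 (intPt k) - 1 / T) (nrm2 (intPt k) + 1 / T) :=
            ⟨by linarith, h⟩
          have : e k = 1 := Set.indicator_of_mem hmem _
          rw [this, abs_le]
          constructor <;> linarith [hφ0 k, hφ1 k]
      · rw [if_neg (fun h => hkl h.2), sub_zero, norm_mul, norm_exp_I_mul, one_mul,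
          Complex.norm_real, Real.norm_of_nonneg (hφ0 k)]
        push Not at hkl
        by_cases h : l ≤ nrm2 (intPt k) - 1 / T
        · rw [hout k h]; linarith [he0 k]
        · push Not at h
          have hmem : l ∈ Set.Ioo (nrm2 (intPt k) - 1 / T) (nrm2 (intPt k) + 1 / T) :=
            ⟨h, by linarith⟩
          have : e k = 1 := Set.indicator_of_mem hmem _
          linarith [hφ1 k]
    · have hk0 : k = 0 := by
        have := (norm_le_nrm2_intPt k).trans (not_lt.1 hk)
        exact norm_le_zero_iff.1 this
      rw [if_neg (fun h => hk h.1), sub_zero, norm_mul, norm_exp_I_mul, one_mul,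
          Complex.norm_real, Real.norm_of_nonneg (hφ0 k), if_pos hk0]
      linarith [hφ1 k, he0 k]
  refine (norm_sum_le _ _).trans ((Finset.sum_le_sum fun k _ => hterm k).trans ?_)
  rw [Finset.sum_add_distrib]
  refine add_le_add ?_ ?_
  · rw [Finset.sum_ite_eq']
    split_ifs <;> norm_num
  · rw [← Finset.sum_filter_ne_zero]
    refine Finset.sum_le_sum_of_subset_of_nonneg (fun k hk => ?_) fun k _ _ => he0 k
    have h := Set.mem_of_indicator_ne_zero (Finset.mem_filter.1 hk).2
    exact mem_intBox.2 ((norm_le_nrm2_intPt k).trans (by linarith [h.1]))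

/-- The smoothing factor of the frequency `rad x m` at scale `1 / T`. -/
noncomputable def cutoff (x : ℝ × ℝ) (T : ℝ) (m : ℤ × ℤ) : ℝ := discFT (1 / T * rad x m) / π

/-- The amplitude of the frequency `rad x m`. -/
noncomputable def amp (x : ℝ × ℝ) (m : ℤ × ℤ) : ℝ :=
  2 / ((2 * π) ^ (3 / 2 : ℝ) * rad x m ^ (3 / 2 : ℝ))

lemma amp_nonneg (x : ℝ × ℝ) (m : ℤ × ℤ) : 0 ≤ amp x m := by
  have := rad_nonneg x m
  have := Real.pi_pos
  unfold amp
  positivity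

lemma two_div_two_pi_rpow : 2 / (2 * π) ^ (3 / 2 : ℝ) ≤ 1 := by
  have h2 : (2 : ℝ) ≤ 2 * π := by linarith [Real.pi_gt_three]
  rw [div_le_one (by positivity)]
  calc (2 : ℝ) ≤ 2 * π := h2
    _ = (2 * π) ^ (1 : ℝ) := (Real.rpow_one _).symm
    _ ≤ (2 * π) ^ (3 / 2 : ℝ) := Real.rpow_le_rpow_of_exponent_le (by linarith) (by norm_num)

lemma amp_eq (x : ℝ × ℝ) (m : ℤ × ℤ) :
    amp x m = 2 / (2 * π) ^ (3 / 2 : ℝ) * rad x m ^ (-(3 / 2) : ℝ) := by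
  rw [amp, Real.rpow_neg (rad_nonneg _ _), div_mul_eq_div_div, div_eq_mul_inv (2 / _)]

lemma abs_cutoff_le (x : ℝ × ℝ) (T : ℝ) (m : ℤ × ℤ) : |cutoff x T m| ≤ 4 := by
  rw [cutoff, abs_div, abs_of_pos Real.pi_pos]
  refine (div_le_self (abs_nonneg _) (by linarith [Real.pi_gt_three])).trans (abs_discFT_le _)

lemma exists_cutoff_mul_amp_le {x : ℝ × ℝ}
    (hx : ¬ ∃ m : ℤ × ℤ, x = (2 * Real.pi * m.1, 2 * Real.pi * m.2)) :
    ∃ C : ℝ, 0 < C ∧ ∀ T > 0, ∀ m, |cutoff x T m * amp x m| ≤ C * radWeight x T m := by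
  obtain ⟨C, hC, h⟩ := exists_discFT_decay
  refine ⟨C, hC, fun T hT m => ?_⟩
  have hr := rad_pos hx m
  have h1 := h (1 / T * rad x m) (by positivity)
  rw [show 1 / (1 / T * rad x m) = T / rad x m by field_simp] at h1
  have h2 : |cutoff x T m| ≤ C * min 1 (T / rad x m) ^ (3 / 2 : ℝ) := by
    rw [cutoff, abs_div, abs_of_pos Real.pi_pos]
    exact (div_le_self (abs_nonneg _) (by linarith [Real.pi_gt_three])).trans h1
  have h3 : amp x m ≤ rad x m ^ (-(3 / 2) : ℝ) := by
    rw [amp_eq]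
    exact mul_le_of_le_one_left (by positivity) two_div_two_pi_rpow
  rw [abs_mul, abs_of_nonneg (amp_nonneg x m), radWeight]
  calc _ ≤ (C * min 1 (T / rad x m) ^ (3 / 2 : ℝ)) * rad x m ^ (-(3 / 2) : ℝ) :=
        mul_le_mul h2 h3 (amp_nonneg x m) ((abs_nonneg _).trans h2)
    _ = _ := by ring

lemma summable_radWeight {x : ℝ × ℝ}
    (hx : ¬ ∃ m : ℤ × ℤ, x = (2 * Real.pi * m.1, 2 * Real.pi * m.2)) {T : ℝ} (hT : 0 < T) :
    Summable (radWeight x T) := by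
  refine Summable.of_nonneg_of_le (radWeight_nonneg x hT.le) (fun m => ?_)
    ((summable_rad_rpow hx (p := 3) (by norm_num)).mul_left (T ^ (3 / 2 : ℝ)))
  have hr := rad_pos hx m
  have h0 : 0 < T / rad x m := by positivity
  rw [radWeight]
  calc _ ≤ rad x m ^ (-(3 / 2) : ℝ) * (T / rad x m) ^ (3 / 2 : ℝ) := by
        gcongr
        exact min_le_right _ _
    _ = T ^ (3 / 2 : ℝ) * (rad x m ^ (-(3 / 2) : ℝ) * rad x m ^ (-(3 / 2) : ℝ)) := by
        rw [Real.div_rpow hT.le hr.le, Real.rpow_neg hr.le]; ring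
    _ = _ := by rw [← Real.rpow_add hr]; norm_num

lemma summable_cutoff_mul_amp {x : ℝ × ℝ}
    (hx : ¬ ∃ m : ℤ × ℤ, x = (2 * Real.pi * m.1, 2 * Real.pi * m.2)) {T : ℝ} (hT : 0 < T) :
    Summable fun m => cutoff x T m * amp x m := by
  obtain ⟨C, -, h⟩ := exists_cutoff_mul_amp_le hx
  exact ((summable_radWeight hx hT).mul_left C).of_norm_bounded (h T hT)

lemma tendsto_cutoff (x : ℝ × ℝ) (m : ℤ × ℤ) :
    Tendsto (fun T => cutoff x T m) atTop (nhds 1) := by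
  have h1 : Tendsto (fun T : ℝ => 1 / T * rad x m) atTop (nhds 0) := by
    simpa using tendsto_inv_atTop_zero.mul_const (rad x m)
  have h2 := (continuous_discFT.tendsto 0).comp h1
  rw [discFT_zero] at h2
  simpa [cutoff, Function.comp_def, Real.pi_ne_zero] using h2.div_const π

/-- The leading asymptotics of one frequency. -/
lemma abs_discFT_scaled_sub_le {x : ℝ × ℝ}
    (hx : ¬ ∃ m : ℤ × ℤ, x = (2 * Real.pi * m.1, 2 * Real.pi * m.2)) {l : ℝ} (hl : 0 < l)
    (m : ℤ × ℤ) :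
    |l ^ (-(1 / 2) : ℝ) * (((2 * π) ^ 2)⁻¹ * (l ^ 2 * discFT (l * rad x m)))
      - amp x m * Real.sin (l * rad x m - π / 4)|
      ≤ 4 * Real.Gamma (5 / 2) * rad x m ^ (-(5 / 2) : ℝ) / l := by
  have hr := rad_pos hx m
  set r := rad x m with hrdef
  have hπ := Real.pi_pos
  have h := abs_discFT_sub_le (z := l * r) (by positivity)
  have hw0 : 0 < l ^ (3 / 2 : ℝ) := by positivity
  have hA : l ^ (-(1 / 2) : ℝ) * l ^ 2 = l ^ (3 / 2 : ℝ) := by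
    rw [← Real.rpow_natCast l 2, ← Real.rpow_add hl]; norm_num
  have hamp : amp x m * Real.sin (l * r - π / 4) = l ^ (3 / 2 : ℝ) * ((2 * π) ^ 2)⁻¹ *
      (2 * Real.sqrt (2 * π) * (l * r) ^ (-(3 / 2) : ℝ) * Real.sin (l * r - π / 4)) := by
    rw [amp_eq, Real.mul_rpow hl.le hr.le, Real.rpow_neg hl.le]
    have h1 : Real.sqrt (2 * π) = (2 * π) ^ 2 * ((2 * π) ^ (3 / 2 : ℝ))⁻¹ := by
      rw [Real.sqrt_eq_rpow, ← Real.rpow_natCast (2 * π) 2, ← Real.rpow_neg (by positivity),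
        ← Real.rpow_add (by positivity)]
      norm_num
    rw [h1, ← hrdef]
    field_simp
  rw [hamp, show l ^ (-(1 / 2) : ℝ) * (((2 * π) ^ 2)⁻¹ * (l ^ 2 * discFT (l * r)))
    = l ^ (3 / 2 : ℝ) * ((2 * π) ^ 2)⁻¹ * discFT (l * r) by rw [← hA]; ring, ← mul_sub, abs_mul,
    abs_of_pos (by positivity)]
  have h2 : ((2 * π) ^ 2)⁻¹ ≤ 1 := inv_le_one_of_one_le₀ (by nlinarith [Real.pi_gt_three])
  calc _ ≤ l ^ (3 / 2 : ℝ) * 1 * (4 * Real.Gamma (5 / 2) * (l * r) ^ (-(5 / 2) : ℝ)) := by gcongr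
    _ = 4 * Real.Gamma (5 / 2) * r ^ (-(5 / 2) : ℝ) * (l ^ (3 / 2 : ℝ) * l ^ (-(5 / 2) : ℝ)) := by
        rw [Real.mul_rpow hl.le hr.le]; ring
    _ = _ := by
        rw [← Real.rpow_add hl, div_eq_mul_inv _ l, ← Real.rpow_neg_one l,
          show (3 / 2 : ℝ) + -(5 / 2) = -1 by norm_num]

lemma hasSum_cutoff_mul (x : ℝ × ℝ) {T l : ℝ} (hl : 1 ≤ l) (hlT : l ≤ T) :
    HasSum (fun m : ℤ × ℤ => ((cutoff x T m * (l ^ 2 * discFT (l * rad x m)) : ℝ) : ℂ))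
      (∑ k ∈ intBox (2 * l + 2), Complex.exp (Complex.I * (ip2 x (intPt k) : ℂ)) *
        ((volume.real (disc (1 / T) ∩ {ξ | ξ + intPt k ∈ disc l}) / (π * (1 / T) ^ 2) : ℝ) :
          ℂ)) := by
  have hT : 0 < T := by linarith
  have hδ : 0 < 1 / T := by positivity
  have hδ1 : 1 / T ≤ l := by
    rw [div_le_iff₀ hT]; nlinarith
  have h := (hasSum_discFT_mul x hδ hδ1).mul_left (((π * (1 / T) ^ 2)⁻¹ : ℝ) : ℂ)
  have hterm : (fun m : ℤ × ℤ => ((cutoff x T m * (l ^ 2 * discFT (l * rad x m)) : ℝ) : ℂ))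
      = fun m => (((π * (1 / T) ^ 2)⁻¹ : ℝ) : ℂ) *
        (((1 / T) ^ 2 * discFT (1 / T * rad x m) * (l ^ 2 * discFT (l * rad x m)) : ℝ) : ℂ) := by
    ext m
    rw [← Complex.ofReal_mul]
    congr 1
    rw [cutoff]
    have := Real.pi_ne_zero
    field_simp
  rw [hterm]
  refine (congrArg (HasSum _) ?_).mp h
  rw [Finset.mul_sum]
  refine Finset.sum_congr rfl fun k _ => ?_
  rw [div_eq_inv_mul (volume.real _), Complex.ofReal_mul]
  ring

lemma exists_norm_spectral_sub_le {x : ℝ × ℝ}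
    (hx : ¬ ∃ m : ℤ × ℤ, x = (2 * Real.pi * m.1, 2 * Real.pi * m.2)) :
    ∃ C : ℝ, 0 ≤ C ∧ ∀ T l : ℝ, 1 ≤ l → l ≤ T →
      ‖(l ^ (-(1 / 2) : ℝ) : ℝ) • ((((2 * Real.pi) ^ 2 : ℝ)⁻¹ : ℂ) *
          ∑' k : ℤ × ℤ, (if 0 < nrm2 (intPt k) ∧ nrm2 (intPt k) < l then
            Complex.exp (Complex.I * (ip2 x (intPt k) : ℂ)) else 0))
        - ((∑' m, cutoff x T m * amp x m * Real.sin (l * rad x m - π / 4) : ℝ) : ℂ)‖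
      ≤ l ^ (-(1 / 2) : ℝ) * (1 + edgeCount T l) + C / l := by
  have hs := summable_rad_rpow hx (p := 5 / 2) (by norm_num)
  refine ⟨16 * Real.Gamma (5 / 2) * ∑' m, rad x m ^ (-(5 / 2) : ℝ), ?_, fun T l hl hlT => ?_⟩
  · have : 0 ≤ ∑' m, rad x m ^ (-(5 / 2) : ℝ) :=
      tsum_nonneg fun m => Real.rpow_nonneg (rad_nonneg _ _) _
    have := Real.Gamma_pos_of_pos (show (0 : ℝ) < 5 / 2 by norm_num)
    positivity
  have hT : 0 < T := by linarith
  have hl0 : 0 < l := by linarith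
  have hΓ := Real.Gamma_pos_of_pos (show (0 : ℝ) < 5 / 2 by norm_num)
  have hw : 0 ≤ l ^ (-(1 / 2) : ℝ) := by positivity
  set c : ℝ := l ^ (-(1 / 2) : ℝ) with hc
  set N : ℂ := ∑' k : ℤ × ℤ, (if 0 < nrm2 (intPt k) ∧ nrm2 (intPt k) < l then
    Complex.exp (Complex.I * (ip2 x (intPt k) : ℂ)) else 0) with hN
  set S : ℂ := ∑ k ∈ intBox (2 * l + 2), Complex.exp (Complex.I * (ip2 x (intPt k) : ℂ)) *
    ((volume.real (disc (1 / T) ∩ {ξ | ξ + intPt k ∈ disc l}) / (π * (1 / T) ^ 2) : ℝ) : ℂ)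
    with hS
  have hNS : ‖S - N‖ ≤ 1 + edgeCount T l := norm_smoothed_sub_sharp_le x hl hlT
  have hsum := (hasSum_cutoff_mul x hl hlT).mul_left ((c * ((2 * π) ^ 2)⁻¹ : ℝ) : ℂ)
  rw [← hS] at hsum
  have hsin : Summable fun m => cutoff x T m * amp x m * Real.sin (l * rad x m - π / 4) :=
    (summable_cutoff_mul_amp hx hT).abs.of_norm_bounded fun m => by
      rw [Real.norm_eq_abs, abs_mul]
      exact mul_le_of_le_one_right (abs_nonneg _) (Real.abs_sin_le_one _)
  have hsin' := (Complex.hasSum_ofReal.2 hsin.hasSum)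
  have hdiff := hsum.sub hsin'
  have hbound : ‖((c * ((2 * π) ^ 2)⁻¹ : ℝ) : ℂ) * S
      - ((∑' m, cutoff x T m * amp x m * Real.sin (l * rad x m - π / 4) : ℝ) : ℂ)‖
      ≤ 16 * Real.Gamma (5 / 2) * (∑' m, rad x m ^ (-(5 / 2) : ℝ)) / l := by
    rw [← hdiff.tsum_eq]
    refine tsum_of_norm_bounded (((hs.hasSum.mul_left (16 * Real.Gamma (5 / 2))).div_const l))
      fun m => ?_
    rw [← Complex.ofReal_mul, ← Complex.ofReal_sub, Complex.norm_real, Real.norm_eq_abs]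
    rw [show c * ((2 * π) ^ 2)⁻¹ * (cutoff x T m * (l ^ 2 * discFT (l * rad x m)))
        - cutoff x T m * amp x m * Real.sin (l * rad x m - π / 4)
      = cutoff x T m * (c * (((2 * π) ^ 2)⁻¹ * (l ^ 2 * discFT (l * rad x m)))
        - amp x m * Real.sin (l * rad x m - π / 4)) by ring, abs_mul]
    calc _ ≤ 4 * (4 * Real.Gamma (5 / 2) * rad x m ^ (-(5 / 2) : ℝ) / l) :=
          mul_le_mul (abs_cutoff_le x T m) (abs_discFT_scaled_sub_le hx hl0 m) (abs_nonneg _)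
            (by norm_num)
      _ = _ := by ring
  have hsplit : c • ((((2 * Real.pi) ^ 2 : ℝ)⁻¹ : ℂ) * N)
        - ((∑' m, cutoff x T m * amp x m * Real.sin (l * rad x m - π / 4) : ℝ) : ℂ)
      = ((c * ((2 * π) ^ 2)⁻¹ : ℝ) : ℂ) * (N - S) + (((c * ((2 * π) ^ 2)⁻¹ : ℝ) : ℂ) * S
      - ((∑' m, cutoff x T m * amp x m * Real.sin (l * rad x m - π / 4) : ℝ) : ℂ)) := by
    rw [Complex.real_smul]
    push_cast
    ring
  rw [hsplit]
  refine (norm_add_le _ _).trans (add_le_add ?_ hbound)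
  rw [norm_mul, Complex.norm_real, Real.norm_of_nonneg (by positivity), norm_sub_rev]
  have h2 : ((2 * π) ^ 2)⁻¹ ≤ 1 := inv_le_one_of_one_le₀ (by nlinarith [Real.pi_gt_three])
  exact mul_le_mul (mul_le_of_le_one_right hw h2) hNS (norm_nonneg _) hw

/-- The truncated expansion differs from the smoothed one by a high-frequency tail and a term
that is uniformly small for large `T`. -/
lemma abs_tsum_cutoff_sub_le {x : ℝ × ℝ}
    (hx : ¬ ∃ m : ℤ × ℤ, x = (2 * Real.pi * m.1, 2 * Real.pi * m.2)) (Q l : ℝ) {T : ℝ}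
    (hT : 0 < T) :
    |∑' m, cutoff x T m * amp x m * Real.sin (l * rad x m - π / 4)
      - (∑' m : ℤ × ℤ, if nrm2 (2 * Real.pi * m.1, 2 * Real.pi * m.2) ≤ Q then
          2 * Real.sin (l * rad x m - π / 4) /
            ((2 * π) ^ ((3 : ℝ) / 2) * rad x m ^ ((3 : ℝ) / 2)) else 0)
      - ∑' m : ℤ × ℤ, (if nrm2 (2 * Real.pi * m.1, 2 * Real.pi * m.2) ≤ Q then 0
          else cutoff x T m * amp x m) * Real.sin (l * rad x m - π / 4)|
      ≤ ∑ m ∈ (finite_nrm2_le Q).toFinset, |cutoff x T m - 1| * amp x m := by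
  set F := (finite_nrm2_le Q).toFinset with hF
  have hmem : ∀ m : ℤ × ℤ, m ∈ F ↔ nrm2 (2 * Real.pi * m.1, 2 * Real.pi * m.2) ≤ Q := by
    intro m; rw [hF, Set.Finite.mem_toFinset, Set.mem_ofPred_eq]
  have hsin : ∀ b : ℤ × ℤ → ℝ, (∀ m, |b m| ≤ |cutoff x T m * amp x m|) →
      Summable fun m => b m * Real.sin (l * rad x m - π / 4) := fun b hb =>
    (summable_cutoff_mul_amp hx hT).abs.of_norm_bounded fun m => by
      rw [Real.norm_eq_abs, abs_mul]
      exact (mul_le_of_le_one_right (abs_nonneg _) (Real.abs_sin_le_one _)).trans (hb m)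
  have h1 := (hsin _ fun m => le_rfl).tsum_sub (hsin (fun m =>
    if nrm2 (2 * Real.pi * m.1, 2 * Real.pi * m.2) ≤ Q then 0 else cutoff x T m * amp x m)
      fun m => by
        split_ifs
        · rw [abs_zero]; exact abs_nonneg _
        · exact le_rfl)
  rw [sub_right_comm, ← h1, tsum_eq_sum (s := F) (fun m hm => by
    rw [hmem] at hm; rw [if_neg hm, sub_self]), tsum_eq_sum (s := F) (fun m hm => by
    rw [hmem] at hm; rw [if_neg hm]), ← Finset.sum_sub_distrib]
  refine (Finset.abs_sum_le_sum_abs _ _).trans (Finset.sum_le_sum fun m hm => ?_)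
  rw [hmem] at hm
  rw [if_pos hm, if_pos hm]
  have : cutoff x T m * amp x m * Real.sin (l * rad x m - π / 4)
      - 0 * Real.sin (l * rad x m - π / 4) - 2 * Real.sin (l * rad x m - π / 4) /
            ((2 * π) ^ ((3 : ℝ) / 2) * rad x m ^ ((3 : ℝ) / 2))
      = (cutoff x T m - 1) * amp x m * Real.sin (l * rad x m - π / 4) := by
    rw [amp]; ring
  rw [this, abs_mul, abs_mul, abs_of_nonneg (amp_nonneg x m)]
  exact mul_le_of_le_one_right (mul_nonneg (abs_nonneg _) (amp_nonneg x m)) (Real.abs_sin_le_one _)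

/-- The difference between the rescaled spectral function and its expansion truncated at `Q`. -/
noncomputable def remainder (x : ℝ × ℝ) (Q l : ℝ) : ℂ :=
  (l ^ (-(1 / 2) : ℝ) : ℝ) • ((((2 * Real.pi) ^ 2 : ℝ)⁻¹ : ℂ) *
      ∑' k : ℤ × ℤ, (if 0 < nrm2 (intPt k) ∧ nrm2 (intPt k) < l then
        Complex.exp (Complex.I * (ip2 x (intPt k) : ℂ)) else 0))
    - ((∑' m : ℤ × ℤ, if nrm2 (2 * Real.pi * m.1, 2 * Real.pi * m.2) ≤ Q then
          2 * Real.sin (l * rad x m - π / 4) /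
            ((2 * π) ^ ((3 : ℝ) / 2) * rad x m ^ ((3 : ℝ) / 2)) else 0 : ℝ) : ℂ)

/-- The coefficients of the smoothed expansion beyond frequency `Q`. -/
noncomputable def tailCoeff (x : ℝ × ℝ) (Q T : ℝ) (m : ℤ × ℤ) : ℝ :=
  if nrm2 (2 * Real.pi * m.1, 2 * Real.pi * m.2) ≤ Q then 0 else cutoff x T m * amp x m

lemma summable_tailCoeff {x : ℝ × ℝ}
    (hx : ¬ ∃ m : ℤ × ℤ, x = (2 * Real.pi * m.1, 2 * Real.pi * m.2)) (Q : ℝ) {T : ℝ}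
    (hT : 0 < T) : Summable (tailCoeff x Q T) :=
  (summable_cutoff_mul_amp hx hT).abs.of_norm_bounded fun m => by
    unfold tailCoeff
    split_ifs
    · rw [norm_zero]; exact abs_nonneg _
    · exact le_rfl

lemma exists_norm_remainder_sq_le {x : ℝ × ℝ}
    (hx : ¬ ∃ m : ℤ × ℤ, x = (2 * Real.pi * m.1, 2 * Real.pi * m.2)) :
    ∃ C : ℝ, 0 ≤ C ∧ ∀ Q T l : ℝ, 1 ≤ l → l ≤ T →
      ‖remainder x Q l‖ ^ 2 ≤ 4 * ((1 + edgeCount T l) ^ 2 / l + C / l ^ 2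
        + (∑ m ∈ (finite_nrm2_le Q).toFinset, |cutoff x T m - 1| * amp x m) ^ 2
        + (∑' m, tailCoeff x Q T m * Real.sin (l * rad x m - π / 4)) ^ 2) := by
  obtain ⟨C, hC, h⟩ := exists_norm_spectral_sub_le hx
  refine ⟨C ^ 2, by positivity, fun Q T l hl hlT => ?_⟩
  have hl0 : 0 < l := by linarith
  have hT : 0 < T := by linarith
  have h1 := h T l hl hlT
  have h2 := abs_tsum_cutoff_sub_le hx Q l hT
  set A := ∑ m ∈ (finite_nrm2_le Q).toFinset, |cutoff x T m - 1| * amp x m with hA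
  set B := ∑' m, tailCoeff x Q T m * Real.sin (l * rad x m - π / 4) with hB
  set P := ∑' m, cutoff x T m * amp x m * Real.sin (l * rad x m - π / 4) with hP
  set J := ∑' m : ℤ × ℤ, (if nrm2 (2 * Real.pi * m.1, 2 * Real.pi * m.2) ≤ Q then
          2 * Real.sin (l * rad x m - π / 4) /
            ((2 * π) ^ ((3 : ℝ) / 2) * rad x m ^ ((3 : ℝ) / 2)) else 0) with hJ
  have h2' : |P - J - B| ≤ A := h2
  set u := l ^ (-(1 / 2) : ℝ) * (1 + edgeCount T l) with hu
  have hu2 : u ^ 2 = (1 + edgeCount T l) ^ 2 / l := by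
    rw [hu, mul_pow, ← Real.rpow_natCast (l ^ _) 2, ← Real.rpow_mul hl0.le,
      div_eq_mul_inv _ l, ← Real.rpow_neg_one l, mul_comm]
    norm_num
  have h3 : ‖remainder x Q l‖ ≤ u + C / l + A + |B| := by
    set Y : ℂ := (l ^ (-(1 / 2) : ℝ) : ℝ) • ((((2 * Real.pi) ^ 2 : ℝ)⁻¹ : ℂ) *
          ∑' k : ℤ × ℤ, (if 0 < nrm2 (intPt k) ∧ nrm2 (intPt k) < l then
            Complex.exp (Complex.I * (ip2 x (intPt k) : ℂ)) else 0)) with hY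
    have h4 : remainder x Q l = (Y - (P : ℂ)) + (((P - J - B : ℝ) : ℂ) + (B : ℂ)) := by
      rw [remainder, ← hY, ← hJ]
      push_cast
      ring
    rw [h4]
    refine (norm_add_le _ _).trans ?_
    have h5 := norm_add_le ((P - J - B : ℝ) : ℂ) (B : ℂ)
    rw [Complex.norm_real, Complex.norm_real, Real.norm_eq_abs, Real.norm_eq_abs] at h5
    linarith
  rw [← hu2, ← div_pow, ← sq_abs B]
  calc ‖remainder x Q l‖ ^ 2 ≤ (u + C / l + A + |B|) ^ 2 := by gcongr
    _ ≤ _ := by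
      nlinarith [sq_nonneg (u - C / l), sq_nonneg (u - A), sq_nonneg (u - |B|),
        sq_nonneg (C / l - A), sq_nonneg (C / l - |B|), sq_nonneg (A - |B|)]

lemma exists_integral_tail_sq_le {x : ℝ × ℝ}
    (hx : ¬ ∃ m : ℤ × ℤ, x = (2 * Real.pi * m.1, 2 * Real.pi * m.2)) {ε : ℝ} (hε : 0 < ε) :
    ∃ Q₀ : ℝ, ∀ Q ≥ Q₀, ∀ T ≥ 1,
      ∫ l in (1 : ℝ)..T, (∑' m, tailCoeff x Q T m * Real.sin (l * rad x m - π / 4)) ^ 2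
        ≤ ε * T := by
  obtain ⟨C, hC, hCw⟩ := exists_cutoff_mul_amp_le hx
  have hM : 0 < Real.exp 1 * √π * C ^ 2 := by
    have := Real.exp_pos 1
    have := Real.sqrt_pos.2 Real.pi_pos
    positivity
  obtain ⟨Q₀, hQ₀⟩ := exists_radWeight_tail hx (div_pos hε hM)
  refine ⟨Q₀, fun Q hQ T hT => ?_⟩
  have hT0 : 0 < T := by linarith
  have hK : ∀ s : Finset (ℤ × ℤ), ∑ i ∈ s, ∑ j ∈ s, |tailCoeff x Q T i| * |tailCoeff x Q T j| *
      Real.exp (-(T ^ 2 * (rad x i - rad x j) ^ 2 / 4))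
      ≤ C ^ 2 * (ε / (Real.exp 1 * √π * C ^ 2)) := by
    intro s
    have hne : ∀ m, tailCoeff x Q T m ≠ 0 →
        Q < nrm2 (2 * Real.pi * m.1, 2 * Real.pi * m.2) := by
      intro m hm
      by_contra hcon
      exact hm (if_pos (not_lt.1 hcon))
    have hle : ∀ m, |tailCoeff x Q T m| ≤ C * radWeight x T m := by
      intro m
      unfold tailCoeff
      split_ifs
      · rw [abs_zero]
        exact mul_nonneg hC.le (radWeight_nonneg x hT0.le m)
      · exact hCw T hT0 m
    classical
    have h := hQ₀ Q hQ T hT0 (s.filter fun m =>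
      Q < nrm2 (2 * Real.pi * (m.1 : ℝ), 2 * Real.pi * (m.2 : ℝ)))
      fun m hm => (Finset.mem_filter.1 hm).2
    rw [← Finset.sum_filter_of_ne (p := fun m : ℤ × ℤ =>
      Q < nrm2 (2 * Real.pi * (m.1 : ℝ), 2 * Real.pi * (m.2 : ℝ)))]
    swap
    · intro i _ hi
      refine hne i fun h0 => hi ?_
      simp [h0]
    refine le_trans ?_ (mul_le_mul_of_nonneg_left h (sq_nonneg C))
    rw [Finset.mul_sum]
    refine Finset.sum_le_sum fun i _ => ?_
    rw [← Finset.sum_filter_of_ne (p := fun m : ℤ × ℤ =>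
      Q < nrm2 (2 * Real.pi * (m.1 : ℝ), 2 * Real.pi * (m.2 : ℝ)))]
    swap
    · intro j _ hj
      refine hne j fun h0 => hj ?_
      simp [h0]
    rw [Finset.mul_sum]
    refine Finset.sum_le_sum fun j _ => ?_
    rw [← mul_assoc]
    refine mul_le_mul_of_nonneg_right ?_ (Real.exp_pos _).le
    calc _ ≤ (C * radWeight x T i) * (C * radWeight x T j) :=
          mul_le_mul (hle i) (hle j) (abs_nonneg _) ((abs_nonneg _).trans (hle i))
      _ = _ := by ring
  refine (integral_sq_tsum_sin_le (summable_tailCoeff hx Q hT0) (π / 4) hT hK).trans (le_of_eq ?_)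
  field_simp

lemma integral_inv_sq_le {T : ℝ} (hT : 1 ≤ T) : ∫ l in (1 : ℝ)..T, 1 / l ^ 2 ≤ 1 := by
  have h0 : (0 : ℝ) ∉ Set.uIcc 1 T := by
    rw [Set.uIcc_of_le hT]
    intro h
    linarith [h.1]
  have h := integral_zpow (a := 1) (b := T) (n := -2) (Or.inr ⟨by norm_num, h0⟩)
  have h1 : ∀ l : ℝ, l ^ (-2 : ℤ) = 1 / l ^ 2 := fun l => by
    rw [zpow_neg, one_div]; norm_cast
  simp only [h1] at h
  rw [h]
  have : 0 ≤ T ^ (-1 : ℤ) := by positivity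
  norm_num
  linarith [inv_nonneg.2 (show 0 ≤ T by linarith)]

/-- The mean square of the remainder is eventually small. -/
lemma exists_meanSquare_remainder_le {x : ℝ × ℝ}
    (hx : ¬ ∃ m : ℤ × ℤ, x = (2 * Real.pi * m.1, 2 * Real.pi * m.2)) {ε : ℝ} (hε : 0 < ε) :
    ∃ Q₀ : ℝ, ∀ Q ≥ Q₀, ∀ᶠ T in atTop,
      (1 / T) * ∫ l in (1 : ℝ)..T, ‖remainder x Q l‖ ^ 2 ≤ ε := by
  obtain ⟨C, hC, hrem⟩ := exists_norm_remainder_sq_le hx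
  obtain ⟨K, hK, hedge⟩ := exists_edgeCount_sq_le (show 0 < ε / 816 by positivity)
  obtain ⟨Q₀, htail⟩ := exists_integral_tail_sq_le hx (show 0 < ε / 16 by positivity)
  refine ⟨Q₀, fun Q hQ => ?_⟩
  have hA : Tendsto (fun T => (∑ m ∈ (finite_nrm2_le Q).toFinset,
      |cutoff x T m - 1| * amp x m) ^ 2) atTop (nhds 0) := by
    have : Tendsto (fun T => ∑ m ∈ (finite_nrm2_le Q).toFinset, |cutoff x T m - 1| * amp x m)
        atTop (nhds (∑ m ∈ (finite_nrm2_le Q).toFinset, |(1 : ℝ) - 1| * amp x m)) :=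
      tendsto_finsetSum _ fun m _ => (((tendsto_cutoff x m).sub_const 1).abs.mul_const _)
    simpa using this.pow 2
  have hKT : Tendsto (fun T : ℝ => (K + C) / T) atTop (nhds 0) := tendsto_const_nhds.div_atTop tendsto_id
  filter_upwards [eventually_ge_atTop 1, hA.eventually (ge_mem_nhds (show 0 < ε / 16 by positivity)),
    hKT.eventually (ge_mem_nhds (show 0 < ε / 16 by positivity))] with T hT hAT hKCT
  have hT0 : 0 < T := by linarith
  set A := ∑ m ∈ (finite_nrm2_le Q).toFinset, |cutoff x T m - 1| * amp x m with hAdef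
  set B : ℝ → ℝ := fun l => ∑' m, tailCoeff x Q T m * Real.sin (l * rad x m - π / 4) with hB
  have hBc : Continuous B := continuous_tsum_sin (summable_tailCoeff hx Q hT0) _
  set G : ℝ → ℝ := fun l => 4 * (ε / 816 * (1 + edgeCount T l) + (K + C) * (1 / l ^ 2) + A ^ 2
    + B l ^ 2) with hG
  have hi1 : IntervalIntegrable (fun l => ε / 816 * (1 + edgeCount T l)) volume 1 T :=
    (intervalIntegrable_const.add (integrable_edgeCount T).intervalIntegrable).const_mul _
  have hi2 : IntervalIntegrable (fun l : ℝ => (K + C) * (1 / l ^ 2)) volume 1 T := by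
    refine ContinuousOn.intervalIntegrable ?_
    refine continuousOn_const.mul (continuousOn_const.div (by fun_prop) fun l hl => ?_)
    rw [Set.uIcc_of_le hT] at hl
    have : 0 < l := by linarith [hl.1]
    positivity
  have hi3 : IntervalIntegrable (fun l => B l ^ 2) volume 1 T :=
    (hBc.pow 2).intervalIntegrable _ _
  have hiA : IntervalIntegrable (fun _ => A ^ 2) volume 1 T := intervalIntegrable_const
  have hGi : IntervalIntegrable G volume 1 T := (((hi1.add hi2).add hiA).add hi3).const_mul 4
  have hle : ∫ l in (1 : ℝ)..T, ‖remainder x Q l‖ ^ 2 ≤ ∫ l in (1 : ℝ)..T, G l := by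
    rw [intervalIntegral.integral_of_le hT, intervalIntegral.integral_of_le hT]
    refine integral_mono_of_nonneg (Eventually.of_forall fun l => by positivity)
      ((intervalIntegrable_iff_integrableOn_Ioc_of_le hT).1 hGi)
      ((ae_restrict_iff' measurableSet_Ioc).2 (Eventually.of_forall fun l hl => ?_))
    have h1 := hrem Q T l hl.1.le hl.2
    have h2 := hedge T l hl.1.le hl.2
    have h3 : (K + C) * (1 / l ^ 2) = K / l ^ 2 + C / l ^ 2 := by ring
    simp only [hG, h3]
    linarith
  have hGval : ∫ l in (1 : ℝ)..T, G l ≤ 4 * (ε / 816 * (51 * T) + (K + C) * 1 + A ^ 2 * T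
      + ε / 16 * T) := by
    simp only [hG]
    rw [intervalIntegral.integral_const_mul, intervalIntegral.integral_add ((hi1.add hi2).add hiA) hi3,
      intervalIntegral.integral_add (hi1.add hi2) hiA, intervalIntegral.integral_add hi1 hi2,
      intervalIntegral.integral_const_mul, intervalIntegral.integral_const_mul,
      intervalIntegral.integral_add intervalIntegrable_const
        (integrable_edgeCount T).intervalIntegrable, intervalIntegral.integral_const,
      intervalIntegral.integral_const]
    have h1 := integral_edgeCount_le hT
    have h2 := integral_inv_sq_le hT
    have h3 := htail Q hQ T hT
    have h4 : ε / 816 * ((T - 1) • (1 : ℝ) + ∫ l in (1 : ℝ)..T, edgeCount T l)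
        ≤ ε / 816 * (51 * T) := by
      refine mul_le_mul_of_nonneg_left ?_ (by positivity)
      rw [smul_eq_mul]; linarith
    have h5 := mul_le_mul_of_nonneg_left h2 (add_nonneg hK hC)
    have h6 : (T - 1) • A ^ 2 ≤ A ^ 2 * T := by
      rw [smul_eq_mul]; nlinarith [sq_nonneg A]
    linarith
  rw [one_div, inv_mul_le_iff₀ hT0]
  have hKC' : K + C ≤ ε / 16 * T := by
    rwa [div_le_iff₀ hT0] at hKCT
  have hAT' : A ^ 2 * T ≤ ε / 16 * T := mul_le_mul_of_nonneg_right hAT hT0.le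
  linarith

/-- The rescaled spectral function
`λ^{−1/2} N_{x,0}(λ)` of the Laplacian on the flat square torus `ℝ²/(2πℤ)²`,
with `N_x(λ) = (2π)^{−2} Σ_{0<|k|<λ} e^{i⟨x,k⟩}`, is Besicovitch `B²`-almost
periodic with expansion
`Σ_{η∈2πℤ²} 2 sin(λ|x+η| − π/4)/((2π)^{3/2}|x+η|^{3/2})`. -/
theorem torus2_rescaled_spectral_function_besicovitch
    (x : ℝ × ℝ) (hx : ¬ ∃ m : ℤ × ℤ, x = (2 * Real.pi * m.1, 2 * Real.pi * m.2)) :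
    Filter.Tendsto (fun Q : ℝ =>
      Filter.limsup (fun T : ℝ => (1 / T) *
        ∫ l in (1 : ℝ)..T,
          ‖(l ^ (-(1 / 2) : ℝ) : ℝ) •
              ((((2 * Real.pi) ^ 2 : ℝ)⁻¹ : ℂ) *
                ∑' k : ℤ × ℤ,
                  if 0 < nrm2 ((k.1 : ℝ), (k.2 : ℝ)) ∧ nrm2 ((k.1 : ℝ), (k.2 : ℝ)) < l then
                    Complex.exp (Complex.I * (ip2 x ((k.1 : ℝ), (k.2 : ℝ)) : ℂ))
                  else 0)
            - ((∑' m : ℤ × ℤ,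
                if nrm2 (2 * Real.pi * m.1, 2 * Real.pi * m.2) ≤ Q then
                  2 * Real.sin (l * nrm2 (x.1 + 2 * Real.pi * m.1, x.2 + 2 * Real.pi * m.2)
                        - Real.pi / 4) /
                    ((2 * Real.pi) ^ ((3 : ℝ) / 2) *
                      nrm2 (x.1 + 2 * Real.pi * m.1, x.2 + 2 * Real.pi * m.2) ^ ((3 : ℝ) / 2))
                else 0 : ℝ) : ℂ)‖ ^ 2)
        Filter.atTop)
      Filter.atTop (nhds 0) := by
  change Tendsto (fun Q : ℝ => limsup (fun T : ℝ => (1 / T) *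
    ∫ l in (1 : ℝ)..T, ‖remainder x Q l‖ ^ 2) atTop) atTop (nhds 0)
  refine Metric.tendsto_atTop.2 fun ε hε => ?_
  obtain ⟨Q₀, hQ₀⟩ := exists_meanSquare_remainder_le hx (half_pos hε)
  refine ⟨Q₀, fun Q hQ => ?_⟩
  have hle := hQ₀ Q hQ
  have hnonneg : ∀ᶠ T : ℝ in atTop,
      0 ≤ (1 / T) * ∫ l in (1 : ℝ)..T, ‖remainder x Q l‖ ^ 2 := by
    filter_upwards [eventually_ge_atTop 1] with T hT
    have h := intervalIntegral.integral_nonneg (μ := volume) hT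
      (fun l _ => sq_nonneg ‖remainder x Q l‖)
    have : 0 ≤ T := by linarith
    positivity
  have hbdd : IsBoundedUnder (· ≤ ·) atTop fun T : ℝ =>
      (1 / T) * ∫ l in (1 : ℝ)..T, ‖remainder x Q l‖ ^ 2 := ⟨_, eventually_map.2 hle⟩
  have hcob : IsCoboundedUnder (· ≤ ·) atTop fun T : ℝ =>
      (1 / T) * ∫ l in (1 : ℝ)..T, ‖remainder x Q l‖ ^ 2 :=
    IsBoundedUnder.isCoboundedUnder_le ⟨0, eventually_map.2 hnonneg⟩
  have h1 := limsup_le_of_le hcob hle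
  have h2 := le_limsup_of_frequently_le hnonneg.frequently hbdd
  rw [Real.dist_eq, sub_zero, abs_of_nonneg h2]
  linarith
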